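/- arXiv:1310.1789 — 2 statements merged into one kernel-verified Lean document; each statement's English description precedes it below -/
import Mathlib

section
/- The function γ satisfies: (1) γ is strictly decreasing on [0,∞); (2) γ is continuous on (0,∞); (3) for every q ≥ 0, γ(q) = lim_{k→∞} γ_k(q); (4) γ(1) = 0 and γ(q) → −∞ as q → ∞; (5) γ is convex on (0,∞). -/
open MeasureTheory Filter Set

attribute [local instance] Classical.propDecidable

noncomputable section

/-- Data of a box-like planar self-affine IFS: each map is `S i = T i ∘ L i + t i`, where
`T i` is the diagonal contraction `diag (c i, d i)` with `c i, d i ∈ (0,1)` and `L i` is a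
linear isometry of the plane preserving `[-1,1]²`, i.e. one of the eight symmetries of the
square, encoded by whether it swaps the two axes (`swap`) and by a sign on each coordinate. -/
structure IFSData (ι : Type) where
  c : ι → ℝ
  d : ι → ℝ
  swap : ι → Bool
  sgn1 : ι → Bool
  sgn2 : ι → Bool
  t : ι → ℝ × ℝ

namespace IFSData

variable {ι : Type}

/-- The affine contraction `S i = T i ∘ L i + t i`. -/
def S (B : IFSData ι) (i : ι) (x : ℝ × ℝ) : ℝ × ℝ :=
  ((if B.sgn1 i then 1 else -1) * (B.c i * (if B.swap i then x.2 else x.1)) + (B.t i).1,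
   (if B.sgn2 i then 1 else -1) * (B.d i * (if B.swap i then x.1 else x.2)) + (B.t i).2)

/-- `(b(i), h(i))`: base and height of the rectangle `S_i([0,1]²)` for a finite word `i`. -/
def dims (B : IFSData ι) (l : List ι) : ℝ × ℝ :=
  l.foldr (fun i w =>
    (B.c i * (if B.swap i then w.2 else w.1), B.d i * (if B.swap i then w.1 else w.2))) (1, 1)

/-- `α₁(i)`: the larger singular value of the linear part of `S_i`. -/
def alpha1 (B : IFSData ι) (l : List ι) : ℝ := max (B.dims l).1 (B.dims l).2

/-- `α₂(i)`: the smaller singular value of the linear part of `S_i`. -/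
def alpha2 (B : IFSData ι) (l : List ι) : ℝ := min (B.dims l).1 (B.dims l).2

/-- Whether the composite map of the word maps horizontal lines to vertical lines. -/
def swapW (B : IFSData ι) (l : List ι) : Bool := l.foldr (fun i b => xor (B.swap i) b) false

/-- The composite map `S_{i₁} ∘ ⋯ ∘ S_{i_k}` of a word. -/
def Sw (B : IFSData ι) (l : List ι) : ℝ × ℝ → ℝ × ℝ := l.foldr (fun i f => B.S i ∘ f) id

/-- The word `i` projects onto the first coordinate, i.e. `π_i = π₁`. -/
def usesPi1 (B : IFSData ι) (l : List ι) : Prop :=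
  (B.swapW l = false ∧ (B.dims l).2 ≤ (B.dims l).1) ∨
    (B.swapW l = true ∧ (B.dims l).1 < (B.dims l).2)

/-- The projection `π_i` onto the direction of the longest side of `S_i([0,1]²)`. -/
def projW (B : IFSData ι) (l : List ι) : ℝ × ℝ → ℝ :=
  if B.usesPi1 l then Prod.fst else Prod.snd

/-- The rectangular open set condition. -/
def ROSC (B : IFSData ι) : Prop :=
  ∃ x₁ x₂ y₁ y₂ : ℝ, x₁ < x₂ ∧ y₁ < y₂ ∧
    (∀ i, B.S i '' (Set.Ioo x₁ x₂ ×ˢ Set.Ioo y₁ y₂) ⊆ Set.Ioo x₁ x₂ ×ˢ Set.Ioo y₁ y₂) ∧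
    Pairwise fun i j =>
      Disjoint (B.S i '' (Set.Ioo x₁ x₂ ×ˢ Set.Ioo y₁ y₂))
        (B.S j '' (Set.Ioo x₁ x₂ ×ˢ Set.Ioo y₁ y₂))

end IFSData

/-- `p(i)`: the probability of a finite word. -/
def wordProb {ι : Type} (p : ι → ℝ) (l : List ι) : ℝ := (l.map p).prod

/-- `τ_i(q)`: the value of the `L^q`-spectrum of the projection `π_i μ`. -/
def tauW {ι : Type} (B : IFSData ι) (τ1 τ2 : ℝ → ℝ) (l : List ι) (q : ℝ) : ℝ :=
  if B.usesPi1 l then τ1 q else τ2 q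

/-- The `q`-modified singular value function `ψ^{s,q}`. -/
def psiSV {ι : Type} (B : IFSData ι) (p : ι → ℝ) (τ1 τ2 : ℝ → ℝ) (s q : ℝ) (l : List ι) : ℝ :=
  wordProb p l ^ q * B.alpha1 l ^ tauW B τ1 τ2 l q * B.alpha2 l ^ (s - tauW B τ1 τ2 l q)

/-- `Ψ_k^{s,q} = ∑_{i ∈ I^k} ψ^{s,q}(i)`. -/
def PsiSV {ι : Type} [Fintype ι] (B : IFSData ι) (p : ι → ℝ) (τ1 τ2 : ℝ → ℝ)
    (k : ℕ) (s q : ℝ) : ℝ :=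
  ∑ f : Fin k → ι, psiSV B p τ1 τ2 s q (List.ofFn f)

/-- The lower `L^q`-spectrum of a measure. -/
def lowerLq {X : Type*} [MeasurableSpace X] [PseudoMetricSpace X] (ν : Measure X) (q : ℝ) : ℝ :=
  liminf (fun δ : ℝ =>
      Real.log (∫ x, (ν (Metric.ball x δ)).toReal ^ (q - 1) ∂ν) / (-Real.log δ))
    (nhdsWithin 0 (Set.Ioi 0))

/-- The upper `L^q`-spectrum of a measure. -/
def upperLq {X : Type*} [MeasurableSpace X] [PseudoMetricSpace X] (ν : Measure X) (q : ℝ) : ℝ :=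
  limsup (fun δ : ℝ =>
      Real.log (∫ x, (ν (Metric.ball x δ)).toReal ^ (q - 1) ∂ν) / (-Real.log δ))
    (nhdsWithin 0 (Set.Ioi 0))

/-- The `L^q`-spectrum of `ν` exists and equals `t`. -/
def IsLqSpec {X : Type*} [MeasurableSpace X] [PseudoMetricSpace X]
    (ν : Measure X) (q t : ℝ) : Prop :=
  lowerLq ν q = t ∧ upperLq ν q = t

/-- `α_min = min_{i ∈ I} α₂(i)`. -/
def alphaMin {ι : Type} [Fintype ι] [Nonempty ι] (B : IFSData ι) : ℝ :=
  Finset.univ.inf' Finset.univ_nonempty fun i => min (B.c i) (B.d i)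

/-- `α_max = max_{i ∈ I} α₁(i)`. -/
def alphaMax {ι : Type} [Fintype ι] [Nonempty ι] (B : IFSData ι) : ℝ :=
  Finset.univ.sup' Finset.univ_nonempty fun i => max (B.c i) (B.d i)

/-- `p_max = max_{i ∈ I} p_i`. -/
def pMax {ι : Type} [Fintype ι] [Nonempty ι] (p : ι → ℝ) : ℝ :=
  Finset.univ.sup' Finset.univ_nonempty p

/-- The `δ`-stopping `I_δ`. -/
def stopping {ι : Type} (B : IFSData ι) (δ : ℝ) : Set (List ι) :=
  {l | l ≠ [] ∧ B.alpha2 l < δ ∧ δ ≤ B.alpha2 l.dropLast}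


/-! ### Log-convexity of power integrals -/

section powint
variable {Ω : Type*} [MeasurableSpace Ω] (ν : Measure Ω) [IsProbabilityMeasure ν] (f : Ω → ℝ)

theorem powint_integrable (hfm : Measurable f) (hf0 : ∀ᵐ x ∂ν, 0 < f x) (hf1 : ∀ x, f x ≤ 1)
    (hint : Integrable (fun x => (f x) ^ (-1 : ℝ)) ν) {t : ℝ} (ht : -1 ≤ t) :
    Integrable (fun x => (f x) ^ t) ν := by
  refine hint.mono' (hfm.pow_const t).aestronglyMeasurable ?_
  filter_upwards [hf0] with x hx
  rw [Real.norm_of_nonneg (Real.rpow_nonneg hx.le _)]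
  exact Real.rpow_le_rpow_of_exponent_ge hx (hf1 x) ht

theorem powint_pos (hfm : Measurable f) (hf0 : ∀ᵐ x ∂ν, 0 < f x) (hf1 : ∀ x, f x ≤ 1)
    (hint : Integrable (fun x => (f x) ^ (-1 : ℝ)) ν) {t : ℝ} (ht : -1 ≤ t) :
    0 < ∫ x, (f x) ^ t ∂ν := by
  have hi := powint_integrable ν f hfm hf0 hf1 hint ht
  have h0 : 0 ≤ᵐ[ν] fun x => (f x) ^ t := by
    filter_upwards [hf0] with x hx using Real.rpow_nonneg hx.le _
  refine lt_of_le_of_ne (integral_nonneg_of_ae h0) (fun h => ?_)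
  have := (integral_eq_zero_iff_of_nonneg_ae h0 hi).1 h.symm
  have hF : ∀ᵐ x ∂ν, False := by
    filter_upwards [this, hf0] with x hx hx0
    exact (Real.rpow_pos_of_pos hx0 t).ne' hx
  have h2 : (ae ν).NeBot := inferInstance
  exact hF.exists.elim (fun _ h => h)

theorem powint_anti (hfm : Measurable f) (hf0 : ∀ᵐ x ∂ν, 0 < f x) (hf1 : ∀ x, f x ≤ 1)
    (hint : Integrable (fun x => (f x) ^ (-1 : ℝ)) ν) {t u : ℝ} (ht : -1 ≤ t) (htu : t ≤ u) :
    Real.log (∫ x, (f x) ^ u ∂ν) ≤ Real.log (∫ x, (f x) ^ t ∂ν) := by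
  refine Real.log_le_log (powint_pos ν f hfm hf0 hf1 hint (ht.trans htu)) ?_
  refine integral_mono_ae (powint_integrable ν f hfm hf0 hf1 hint (ht.trans htu))
    (powint_integrable ν f hfm hf0 hf1 hint ht) ?_
  filter_upwards [hf0] with x hx
  exact Real.rpow_le_rpow_of_exponent_ge hx (hf1 x) htu

theorem powint_convex (hfm : Measurable f) (hf0 : ∀ᵐ x ∂ν, 0 < f x) (hf1 : ∀ x, f x ≤ 1)
    (hint : Integrable (fun x => (f x) ^ (-1 : ℝ)) ν) {t u a b : ℝ} (ht : -1 ≤ t) (hu : -1 ≤ u)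
    (ha : 0 ≤ a) (hb : 0 ≤ b) (hab : a + b = 1) :
    Real.log (∫ x, (f x) ^ (a * t + b * u) ∂ν) ≤
      a * Real.log (∫ x, (f x) ^ t ∂ν) + b * Real.log (∫ x, (f x) ^ u ∂ν) := by
  have hE1 := powint_pos ν f hfm hf0 hf1 hint ht
  have hE2 := powint_pos ν f hfm hf0 hf1 hint hu
  have hI1 := powint_integrable ν f hfm hf0 hf1 hint ht
  have hI2 := powint_integrable ν f hfm hf0 hf1 hint hu
  set E1 := ∫ x, (f x) ^ t ∂ν with hE1d
  set E2 := ∫ x, (f x) ^ u ∂ν with hE2d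
  have hv : -1 ≤ a * t + b * u := by nlinarith
  have hI := powint_integrable ν f hfm hf0 hf1 hint hv
  have hE := powint_pos ν f hfm hf0 hf1 hint hv
  have key : ∫ x, (f x) ^ (a * t + b * u) ∂ν ≤ E1 ^ a * E2 ^ b := by
    have h1 : ∫ x, (f x) ^ (a * t + b * u) ∂ν ≤
        ∫ x, (E1 ^ a * E2 ^ b) * (a / E1 * (f x) ^ t + b / E2 * (f x) ^ u) ∂ν := by
      refine integral_mono_ae hI (((hI1.const_mul _).add (hI2.const_mul _)).const_mul _) ?_
      filter_upwards [hf0] with x hx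
      have hA : 0 < (f x) ^ t := Real.rpow_pos_of_pos hx _
      have hB : 0 < (f x) ^ u := Real.rpow_pos_of_pos hx _
      have := Real.geom_mean_le_arith_mean2_weighted ha hb (div_pos hA hE1).le
        (div_pos hB hE2).le hab
      rw [Real.div_rpow hA.le hE1.le, Real.div_rpow hB.le hE2.le, ← Real.rpow_mul hx.le,
        ← Real.rpow_mul hx.le] at this
      have p1 : 0 < E1 ^ a := Real.rpow_pos_of_pos hE1 _
      have p2 : 0 < E2 ^ b := Real.rpow_pos_of_pos hE2 _
      have h3 := mul_le_mul_of_nonneg_left this (mul_pos p1 p2).le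
      have h4 : f x ^ (a * t + b * u) = E1 ^ a * E2 ^ b * (f x ^ (t * a) / E1 ^ a * (f x ^ (u * b) / E2 ^ b)) := by
        rw [Real.rpow_add hx, mul_comm a t, mul_comm b u]
        field_simp
      show f x ^ (a * t + b * u) ≤ (E1 ^ a * E2 ^ b) * (a / E1 * (f x) ^ t + b / E2 * (f x) ^ u)
      rw [h4]
      refine h3.trans (le_of_eq ?_)
      ring
    refine h1.trans (le_of_eq ?_)
    rw [integral_const_mul, integral_add (hI1.const_mul _) (hI2.const_mul _), integral_const_mul,
      integral_const_mul, ← hE1d, ← hE2d, div_mul_cancel₀ _ hE1.ne', div_mul_cancel₀ _ hE2.ne', hab,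
      mul_one]
  refine (Real.log_le_log hE key).trans (le_of_eq ?_)
  rw [Real.log_mul (Real.rpow_pos_of_pos hE1 _).ne' (Real.rpow_pos_of_pos hE2 _).ne',
    Real.log_rpow hE1, Real.log_rpow hE2]
end powint

/-! ### Ball masses of a compactly supported measure on the line -/

section line
variable (ν : Measure ℝ) [IsProbabilityMeasure ν]

theorem ball_meas (δ : ℝ) : Measurable fun x : ℝ => (ν (Metric.ball x δ)).toReal := by
  have hs : MeasurableSet {z : ℝ × ℝ | dist z.2 z.1 < δ} :=
    (isOpen_lt (by fun_prop) continuous_const).measurableSet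
  exact (measurable_measure_prodMk_left (ν := ν) hs).ennreal_toReal

theorem ball_le_one (δ x : ℝ) : (ν (Metric.ball x δ)).toReal ≤ 1 :=
  ENNReal.toReal_le_of_le_ofReal zero_le_one (by simpa using prob_le_one)

/-- The half open interval of side `δ` with index `n`. -/
def cell (δ : ℝ) (n : ℤ) : Set ℝ := {x | ⌊x / δ⌋ = n}

theorem cell_meas (δ : ℝ) (n : ℤ) : MeasurableSet (cell δ n) := by
  have : Measurable fun x : ℝ => ⌊x / δ⌋ := by fun_prop
  exact this (measurableSet_singleton n)

theorem cell_sub_ball {δ : ℝ} (hδ : 0 < δ) {n : ℤ} {x : ℝ} (hx : x ∈ cell δ n) :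
    cell δ n ⊆ Metric.ball x δ := by
  intro y hy
  have h := Int.abs_sub_lt_one_of_floor_eq_floor (show ⌊y / δ⌋ = ⌊x / δ⌋ from hy.trans hx.symm)
  rw [← sub_div, abs_div, abs_of_pos hδ, div_lt_one hδ] at h
  simpa [Real.dist_eq] using h

theorem ball_pos {δ : ℝ} (hδ : 0 < δ) : ∀ᵐ x ∂ν, 0 < (ν (Metric.ball x δ)).toReal := by
  have : ∀ᵐ x ∂ν, ∀ n : ℤ, x ∈ cell δ n → ν (cell δ n) ≠ 0 := by
    rw [ae_all_iff]
    intro n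
    by_cases h : ν (cell δ n) = 0
    · have : ∀ᵐ x ∂ν, x ∉ cell δ n := by simpa [ae_iff] using h
      filter_upwards [this] with x hx hx' using absurd hx' hx
    · exact Eventually.of_forall fun x _ => h
  filter_upwards [this] with x hx
  refine ENNReal.toReal_pos ?_ (measure_ne_top _ _)
  have h1 := hx ⌊x / δ⌋ rfl
  exact fun h => h1 (measure_mono_null (cell_sub_ball hδ rfl) h)

theorem ball_inv_lint {R δ : ℝ} (hδ : 0 < δ) (hR : ∀ᵐ x ∂ν, |x| ≤ R) :
    ∫⁻ x, (ν (Metric.ball x δ))⁻¹ ∂ν ≤ (Finset.Icc ⌊-R / δ⌋ ⌊R / δ⌋).card := by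
  set J := Finset.Icc ⌊-R / δ⌋ ⌊R / δ⌋ with hJ
  have h1 : ∫⁻ x, (ν (Metric.ball x δ))⁻¹ ∂ν ≤
      ∫⁻ x, ∑ n ∈ J, (cell δ n).indicator (fun _ => (ν (cell δ n))⁻¹) x ∂ν := by
    refine lintegral_mono_ae ?_
    filter_upwards [hR] with x hx
    have hmem : ⌊x / δ⌋ ∈ J := by
      rw [hJ, Finset.mem_Icc]
      exact ⟨Int.floor_mono (by gcongr; exact (abs_le.1 hx).1),
        Int.floor_mono (by gcongr; exact (abs_le.1 hx).2)⟩
    refine le_trans ?_ (Finset.single_le_sum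
      (f := fun n => (cell δ n).indicator (fun _ => (ν (cell δ n))⁻¹) x) (fun _ _ => zero_le) hmem)
    have hxc : x ∈ cell δ ⌊x / δ⌋ := rfl
    simp only [indicator_of_mem hxc]
    exact ENNReal.inv_le_inv.2 (measure_mono (cell_sub_ball hδ hxc))
  refine h1.trans ?_
  rw [lintegral_finsetSum _ (fun n _ => measurable_const.indicator (cell_meas δ n))]
  calc _ ≤ ∑ n ∈ J, (1 : ENNReal) := by
        refine Finset.sum_le_sum fun n _ => ?_
        rw [lintegral_indicator (cell_meas δ n), lintegral_const, Measure.restrict_apply_univ]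
        exact ENNReal.inv_mul_le_one _
    _ = _ := by simp

theorem ball_inv_int {R δ : ℝ} (hδ : 0 < δ) (hδ1 : δ ≤ 1) (hR0 : 0 ≤ R) (hR : ∀ᵐ x ∂ν, |x| ≤ R) :
    Integrable (fun x => (ν (Metric.ball x δ)).toReal ^ (-1 : ℝ)) ν ∧
    ∫ x, (ν (Metric.ball x δ)).toReal ^ (-1 : ℝ) ∂ν ≤ (2 * R + 2) / δ := by
  have hl := ball_inv_lint ν hδ hR
  have heq : ∀ x, (ν (Metric.ball x δ)).toReal ^ (-1 : ℝ) = ((ν (Metric.ball x δ))⁻¹).toReal := by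
    intro x
    rw [Real.rpow_neg_one, ENNReal.toReal_inv]
  simp only [heq]
  have hs : MeasurableSet {z : ℝ × ℝ | dist z.2 z.1 < δ} :=
    (isOpen_lt (by fun_prop) continuous_const).measurableSet
  have hm : Measurable fun x : ℝ => (ν (Metric.ball x δ))⁻¹ :=
    (measurable_measure_prodMk_left (ν := ν) hs).inv
  have hfin : ∫⁻ x, (ν (Metric.ball x δ))⁻¹ ∂ν ≠ ⊤ :=
    ne_top_of_le_ne_top (ENNReal.natCast_ne_top _) hl
  refine ⟨integrable_toReal_of_lintegral_ne_top hm.aemeasurable hfin, ?_⟩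
  rw [integral_toReal hm.aemeasurable (ae_lt_top hm hfin)]
  have h2 := ENNReal.toReal_mono (ENNReal.natCast_ne_top _) hl
  refine h2.trans ?_
  rw [ENNReal.toReal_natCast, Int.card_Icc]
  have hle : ⌊-R / δ⌋ ≤ ⌊R / δ⌋ := Int.floor_mono (by gcongr; linarith)
  have h3 : (((⌊R / δ⌋ + 1 - ⌊-R / δ⌋).toNat : ℕ) : ℝ) = (⌊R / δ⌋ : ℝ) + 1 - ⌊-R / δ⌋ := by
    have : (((⌊R / δ⌋ + 1 - ⌊-R / δ⌋).toNat : ℕ) : ℤ) = ⌊R / δ⌋ + 1 - ⌊-R / δ⌋ :=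
      Int.toNat_of_nonneg (by omega)
    exact_mod_cast this
  rw [h3]
  have e1 := Int.floor_le (R / δ)
  have e2 := Int.lt_floor_add_one (-R / δ)
  have e3 : (2 * R + 2) / δ = 2 * (R / δ) + 2 / δ := by ring
  have e4 : (2 : ℝ) ≤ 2 / δ := by rw [le_div_iff₀ hδ]; linarith
  have e5 : -R / δ = -(R / δ) := by ring
  linarith

/-- The `δ`-scale approximation of the `L^q` spectrum. -/
def lqApprox (q δ : ℝ) : ℝ :=
  Real.log (∫ x, (ν (Metric.ball x δ)).toReal ^ (q - 1) ∂ν) / (-Real.log δ)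

theorem lqApprox_one (δ : ℝ) : lqApprox ν 1 δ = 0 := by
  simp [lqApprox]

theorem lqApprox_anti {R δ : ℝ} (hδ : 0 < δ) (hδ1 : δ < 1) (hR0 : 0 ≤ R) (hR : ∀ᵐ x ∂ν, |x| ≤ R)
    {q r : ℝ} (hq : 0 ≤ q) (hqr : q ≤ r) : lqApprox ν r δ ≤ lqApprox ν q δ := by
  have hl : 0 < -Real.log δ := by have := Real.log_neg hδ hδ1; linarith
  have := powint_anti ν _ (ball_meas ν δ) (ball_pos ν hδ) (ball_le_one ν δ)
    (ball_inv_int ν hδ hδ1.le hR0 hR).1 (t := q - 1) (u := r - 1) (by linarith) (by linarith)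
  unfold lqApprox
  gcongr

theorem lqApprox_convex {R δ : ℝ} (hδ : 0 < δ) (hδ1 : δ < 1) (hR0 : 0 ≤ R)
    (hR : ∀ᵐ x ∂ν, |x| ≤ R) {q r a b : ℝ} (hq : 0 ≤ q) (hr : 0 ≤ r) (ha : 0 ≤ a) (hb : 0 ≤ b)
    (hab : a + b = 1) :
    lqApprox ν (a * q + b * r) δ ≤ a * lqApprox ν q δ + b * lqApprox ν r δ := by
  have hl : 0 < -Real.log δ := by have := Real.log_neg hδ hδ1; linarith
  have := powint_convex ν _ (ball_meas ν δ) (ball_pos ν hδ) (ball_le_one ν δ)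
    (ball_inv_int ν hδ hδ1.le hR0 hR).1 (t := q - 1) (u := r - 1) (by linarith) (by linarith)
    ha hb hab
  have e : a * (q - 1) + b * (r - 1) = a * q + b * r - 1 := by linear_combination -hab
  rw [e] at this
  unfold lqApprox
  refine (div_le_div_of_nonneg_right this hl.le).trans (le_of_eq ?_)
  ring

theorem lqApprox_zero_le {R δ : ℝ} (hδ : 0 < δ) (hδ1 : δ < Real.exp (-1)) (hR0 : 0 ≤ R)
    (hR : ∀ᵐ x ∂ν, |x| ≤ R) : lqApprox ν 0 δ ≤ 1 + Real.log (2 * R + 2) := by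
  have hlt : δ < 1 := hδ1.trans (by rw [Real.exp_lt_one_iff]; norm_num)
  have hl : 1 < -Real.log δ := by
    have := Real.log_lt_log hδ hδ1
    rw [Real.log_exp] at this; linarith
  have hi := ball_inv_int ν hδ hlt.le hR0 hR
  have hp := powint_pos ν _ (ball_meas ν δ) (ball_pos ν hδ) (ball_le_one ν δ) hi.1 le_rfl
  have h1 := Real.log_le_log hp hi.2
  rw [Real.log_div (by linarith) hδ.ne'] at h1
  unfold lqApprox
  rw [div_le_iff₀ (by linarith), zero_sub]
  have h2 : 0 ≤ Real.log (2 * R + 2) := Real.log_nonneg (by linarith)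
  nlinarith

theorem lq_tendsto {R : ℝ} (hR0 : 0 ≤ R) (hR : ∀ᵐ x ∂ν, |x| ≤ R) {q t : ℝ} (hq : 0 ≤ q)
    (h : IsLqSpec ν q t) : Tendsto (lqApprox ν q) (nhdsWithin 0 (Ioi 0)) (nhds t) := by
  have hev : ∀ᶠ δ : ℝ in nhdsWithin 0 (Ioi 0), 0 < δ ∧ δ < Real.exp (-1) :=
    Ioo_mem_nhdsGT (Real.exp_pos _)
  have hlt : Real.exp (-1) < 1 := by rw [Real.exp_lt_one_iff]; norm_num
  refine tendsto_of_liminf_eq_limsup h.1 h.2 ?_ ?_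
  · refine ⟨1 + Real.log (2 * R + 2), ?_⟩
    rw [eventually_map]
    filter_upwards [hev] with δ hδ
    exact (lqApprox_anti ν hδ.1 (hδ.2.trans hlt) hR0 hR le_rfl hq).trans
      (lqApprox_zero_le ν hδ.1 hδ.2 hR0 hR)
  · refine ⟨-(q * (1 + Real.log (2 * R + 2))), ?_⟩
    rw [eventually_map]
    filter_upwards [hev] with δ hδ
    have h0 := lqApprox_zero_le ν hδ.1 hδ.2 hR0 hR
    have h2 : 0 ≤ Real.log (2 * R + 2) := Real.log_nonneg (by linarith)
    change _ ≤ lqApprox ν q δ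
    rcases le_total q 1 with hq1 | hq1
    · have := lqApprox_anti ν hδ.1 (hδ.2.trans hlt) hR0 hR hq hq1
      rw [lqApprox_one] at this
      have : 0 ≤ q * (1 + Real.log (2 * R + 2)) := by positivity
      linarith
    · have hq0 : 0 < q := by linarith
      have := lqApprox_convex ν hδ.1 (hδ.2.trans hlt) hR0 hR (q := q) (r := 0) (a := 1 / q)
        (b := 1 - 1 / q) hq le_rfl (by positivity)
        (by rw [sub_nonneg, div_le_one hq0]; exact hq1) (by ring)
      rw [mul_zero, add_zero, one_div_mul_cancel hq0.ne', lqApprox_one] at this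
      have h3 := mul_le_mul_of_nonneg_left this hq
      have h4 : q * (1 / q * lqApprox ν q δ + (1 - 1 / q) * lqApprox ν 0 δ)
          = lqApprox ν q δ + (q - 1) * lqApprox ν 0 δ := by field_simp
      rw [h4] at h3
      nlinarith

/-- Everything needed about an `L^q`-spectrum on `[0,∞)`. -/
theorem lq_props {R : ℝ} (hR0 : 0 ≤ R) (hR : ∀ᵐ x ∂ν, |x| ≤ R) (τ : ℝ → ℝ)
    (h : ∀ q : ℝ, 0 ≤ q → IsLqSpec ν q (τ q)) :
    τ 1 = 0 ∧ (∀ q r : ℝ, 0 ≤ q → q ≤ r → τ r ≤ τ q) ∧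
    (∀ q r a b : ℝ, 0 ≤ q → 0 ≤ r → 0 ≤ a → 0 ≤ b → a + b = 1 →
      τ (a * q + b * r) ≤ a * τ q + b * τ r) := by
  have hT : ∀ q, 0 ≤ q → Tendsto (lqApprox ν q) (nhdsWithin 0 (Ioi 0)) (nhds (τ q)) :=
    fun q hq => lq_tendsto ν hR0 hR hq (h q hq)
  have hev : ∀ᶠ δ : ℝ in nhdsWithin 0 (Ioi 0), 0 < δ ∧ δ < 1 := Ioo_mem_nhdsGT one_pos
  refine ⟨?_, ?_, ?_⟩
  · refine tendsto_nhds_unique (hT 1 zero_le_one) ?_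
    simp only [funext (lqApprox_one ν)]
    exact tendsto_const_nhds
  · intro q r hq hqr
    refine le_of_tendsto_of_tendsto (hT r (hq.trans hqr)) (hT q hq) ?_
    filter_upwards [hev] with δ hδ using lqApprox_anti ν hδ.1 hδ.2 hR0 hR hq hqr
  · intro q r a b hq hr ha hb hab
    refine le_of_tendsto_of_tendsto (hT _ (by positivity))
      (((hT q hq).const_mul a).add ((hT r hr).const_mul b)) ?_
    filter_upwards [hev] with δ hδ using lqApprox_convex ν hδ.1 hδ.2 hR0 hR hq hr ha hb hab
end line

/-! ### Words -/

section words
variable {ι : Type} (B : IFSData ι)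

theorem dims_bounds {m b : ℝ} (hm : 0 < m) (hc : ∀ i, m ≤ B.c i ∧ B.c i ≤ b)
    (hd : ∀ i, m ≤ B.d i ∧ B.d i ≤ b) (l : List ι) :
    (m ^ l.length ≤ (B.dims l).1 ∧ (B.dims l).1 ≤ b ^ l.length) ∧
    (m ^ l.length ≤ (B.dims l).2 ∧ (B.dims l).2 ≤ b ^ l.length) := by
  induction l with
  | nil => simp [IFSData.dims]
  | cons i l ih =>
    have hb : 0 < b := hm.trans_le ((hc i).1.trans (hc i).2)
    have e : B.dims (i :: l) = (B.c i * (if B.swap i then (B.dims l).2 else (B.dims l).1),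
      B.d i * (if B.swap i then (B.dims l).1 else (B.dims l).2)) := rfl
    have h0 : 0 < m ^ l.length := by positivity
    obtain ⟨⟨h1, h2⟩, h3, h4⟩ := ih
    have key : ∀ x y : ℝ, m ≤ x → x ≤ b → m ^ l.length ≤ y → y ≤ b ^ l.length →
        m ^ (l.length + 1) ≤ x * y ∧ x * y ≤ b ^ (l.length + 1) := by
      intro x y hx hx' hy hy'
      rw [pow_succ', pow_succ']
      constructor
      · exact mul_le_mul hx hy h0.le (hm.le.trans hx)
      · exact mul_le_mul hx' hy' (h0.le.trans hy) hb.le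
    rw [e, List.length_cons]
    dsimp only
    split_ifs
    · exact ⟨key _ _ (hc i).1 (hc i).2 h3 h4, key _ _ (hd i).1 (hd i).2 h1 h2⟩
    · exact ⟨key _ _ (hc i).1 (hc i).2 h1 h2, key _ _ (hd i).1 (hd i).2 h3 h4⟩

theorem wordProb_bounds {p : ι → ℝ} {b : ℝ} (hp : ∀ i, 0 < p i ∧ p i ≤ b) (l : List ι) :
    0 < wordProb p l ∧ wordProb p l ≤ b ^ l.length := by
  induction l with
  | nil => simp [wordProb]
  | cons i l ih =>
    have e : wordProb p (i :: l) = p i * wordProb p l := rfl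
    rw [e, List.length_cons, pow_succ']
    exact ⟨mul_pos (hp i).1 ih.1, mul_le_mul (hp i).2 ih.2 ih.1.le ((hp i).1.le.trans (hp i).2)⟩

end words


section psi
variable {ι : Type} (B : IFSData ι) (p : ι → ℝ) (τ1 τ2 : ℝ → ℝ) {m b : ℝ}

theorem psi_eq (hm : 0 < m) (hc : ∀ i, m ≤ B.c i ∧ B.c i ≤ b)
    (hd : ∀ i, m ≤ B.d i ∧ B.d i ≤ b) (s q : ℝ) (l : List ι) :
    psiSV B p τ1 τ2 s q l = wordProb p l ^ q * B.alpha2 l ^ s *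
      (B.alpha1 l / B.alpha2 l) ^ tauW B τ1 τ2 l q := by
  have h := dims_bounds B hm hc hd l
  have h0 : 0 < m ^ l.length := by positivity
  have h2 : 0 < B.alpha2 l := lt_min (h0.trans_le h.1.1) (h0.trans_le h.2.1)
  have h1 : 0 < B.alpha1 l := lt_of_lt_of_le h2 min_le_max
  rw [psiSV, Real.rpow_sub h2, Real.div_rpow h1.le h2.le]
  ring

theorem psi_pos (hm : 0 < m) (hc : ∀ i, m ≤ B.c i ∧ B.c i ≤ b)
    (hd : ∀ i, m ≤ B.d i ∧ B.d i ≤ b) (hp : ∀ i, 0 < p i ∧ p i ≤ b) (s q : ℝ) (l : List ι) :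
    0 < psiSV B p τ1 τ2 s q l := by
  have h := dims_bounds B hm hc hd l
  have h0 : 0 < m ^ l.length := by positivity
  have h2 : 0 < B.alpha2 l := lt_min (h0.trans_le h.1.1) (h0.trans_le h.2.1)
  have h1 : 0 < B.alpha1 l := lt_of_lt_of_le h2 min_le_max
  have h3 := (wordProb_bounds hp l).1
  unfold psiSV
  positivity

theorem psi_mono (hm : 0 < m) (hb : b < 1) (hc : ∀ i, m ≤ B.c i ∧ B.c i ≤ b)
    (hd : ∀ i, m ≤ B.d i ∧ B.d i ≤ b) (hp : ∀ i, 0 < p i ∧ p i ≤ b)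
    (h1a : ∀ q r : ℝ, 0 ≤ q → q ≤ r → τ1 r ≤ τ1 q) (h2a : ∀ q r : ℝ, 0 ≤ q → q ≤ r → τ2 r ≤ τ2 q)
    {s t q r : ℝ} (hst : s ≤ t) (hq : 0 ≤ q) (hqr : q ≤ r) (l : List ι) :
    psiSV B p τ1 τ2 t r l ≤ (b ^ l.length) ^ ((r - q) + (t - s)) * psiSV B p τ1 τ2 s q l := by
  have h := dims_bounds B hm hc hd l
  have h0 : 0 < m ^ l.length := by positivity
  have h2 : 0 < B.alpha2 l := lt_min (h0.trans_le h.1.1) (h0.trans_le h.2.1)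
  have h21 : B.alpha2 l ≤ B.alpha1 l := min_le_max
  have h1 : 0 < B.alpha1 l := lt_of_lt_of_le h2 h21
  have h2b : B.alpha2 l ≤ b ^ l.length := (min_le_left _ _).trans h.1.2
  have hw := wordProb_bounds hp l
  have hbp : 0 < b ^ l.length := h2.trans_le h2b
  have hone : 1 ≤ B.alpha1 l / B.alpha2 l := (one_le_div h2).2 h21
  have hτ : tauW B τ1 τ2 l r ≤ tauW B τ1 τ2 l q := by
    unfold tauW
    split_ifs
    · exact h1a q r hq hqr
    · exact h2a q r hq hqr
  rw [psi_eq B p τ1 τ2 hm hc hd, psi_eq B p τ1 τ2 hm hc hd]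
  have e1 : wordProb p l ^ r ≤ (b ^ l.length) ^ (r - q) * wordProb p l ^ q := by
    have : r = (r - q) + q := by ring
    conv_lhs => rw [this, Real.rpow_add hw.1]
    exact mul_le_mul_of_nonneg_right (Real.rpow_le_rpow hw.1.le hw.2 (by linarith))
      (Real.rpow_nonneg hw.1.le _)
  have e2 : B.alpha2 l ^ t ≤ (b ^ l.length) ^ (t - s) * B.alpha2 l ^ s := by
    have : t = (t - s) + s := by ring
    conv_lhs => rw [this, Real.rpow_add h2]
    exact mul_le_mul_of_nonneg_right (Real.rpow_le_rpow h2.le h2b (by linarith))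
      (Real.rpow_nonneg h2.le _)
  have e3 := Real.rpow_le_rpow_of_exponent_le hone hτ
  have w0 := hw.1
  have : 0 < B.alpha1 l / B.alpha2 l := by positivity
  calc _ ≤ ((b ^ l.length) ^ (r - q) * wordProb p l ^ q) *
        ((b ^ l.length) ^ (t - s) * B.alpha2 l ^ s) *
        (B.alpha1 l / B.alpha2 l) ^ tauW B τ1 τ2 l q := by gcongr
    _ = _ := by rw [Real.rpow_add hbp]; ring

theorem psi_convex (hm : 0 < m) (hc : ∀ i, m ≤ B.c i ∧ B.c i ≤ b)
    (hd : ∀ i, m ≤ B.d i ∧ B.d i ≤ b) (hp : ∀ i, 0 < p i ∧ p i ≤ b)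
    {q r s t x y : ℝ} (hx : 0 ≤ x) (hy : 0 ≤ y) (hxy : x + y = 1)
    (h1 : τ1 (x * q + y * r) ≤ x * τ1 q + y * τ1 r)
    (h2 : τ2 (x * q + y * r) ≤ x * τ2 q + y * τ2 r) (l : List ι) :
    psiSV B p τ1 τ2 (x * s + y * t) (x * q + y * r) l ≤
      x * psiSV B p τ1 τ2 s q l + y * psiSV B p τ1 τ2 t r l := by
  refine le_trans ?_ (Real.geom_mean_le_arith_mean2_weighted hx hy
    (psi_pos B p τ1 τ2 hm hc hd hp s q l).le (psi_pos B p τ1 τ2 hm hc hd hp t r l).le hxy)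
  have h := dims_bounds B hm hc hd l
  have h0 : 0 < m ^ l.length := by positivity
  have g2 : 0 < B.alpha2 l := lt_min (h0.trans_le h.1.1) (h0.trans_le h.2.1)
  have g21 : B.alpha2 l ≤ B.alpha1 l := min_le_max
  have hw := (wordProb_bounds hp l).1
  have hone : 1 ≤ B.alpha1 l / B.alpha2 l := (one_le_div g2).2 g21
  have hτ : tauW B τ1 τ2 l (x * q + y * r) ≤ x * tauW B τ1 τ2 l q + y * tauW B τ1 τ2 l r := by
    unfold tauW
    split_ifs
    · exact h1
    · exact h2
  simp only [psi_eq B p τ1 τ2 hm hc hd]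
  set A := B.alpha1 l / B.alpha2 l
  have hA : 0 < A := by linarith
  have e3 := Real.rpow_le_rpow_of_exponent_le hone hτ
  refine (mul_le_mul_of_nonneg_left e3 (by positivity)).trans (le_of_eq ?_)
  rw [Real.mul_rpow (by positivity) (by positivity), Real.mul_rpow (by positivity) (by positivity),
    Real.mul_rpow (by positivity) (by positivity), Real.mul_rpow (by positivity) (by positivity)]
  simp only [← Real.rpow_mul hA.le, ← Real.rpow_mul hw.le, ← Real.rpow_mul g2.le]
  rw [Real.rpow_add hA, Real.rpow_add hw, Real.rpow_add g2]
  simp only [mul_comm x, mul_comm y]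
  ring

variable [Fintype ι]

theorem Psi_pos [Nonempty ι] (hm : 0 < m) (hc : ∀ i, m ≤ B.c i ∧ B.c i ≤ b)
    (hd : ∀ i, m ≤ B.d i ∧ B.d i ≤ b) (hp : ∀ i, 0 < p i ∧ p i ≤ b) (k : ℕ) (s q : ℝ) :
    0 < PsiSV B p τ1 τ2 k s q :=
  Finset.sum_pos (fun _ _ => psi_pos B p τ1 τ2 hm hc hd hp s q _) Finset.univ_nonempty

theorem Psi_mono (hm : 0 < m) (hb : b < 1) (hc : ∀ i, m ≤ B.c i ∧ B.c i ≤ b)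
    (hd : ∀ i, m ≤ B.d i ∧ B.d i ≤ b) (hp : ∀ i, 0 < p i ∧ p i ≤ b)
    (h1a : ∀ q r : ℝ, 0 ≤ q → q ≤ r → τ1 r ≤ τ1 q) (h2a : ∀ q r : ℝ, 0 ≤ q → q ≤ r → τ2 r ≤ τ2 q)
    {s t q r : ℝ} (hst : s ≤ t) (hq : 0 ≤ q) (hqr : q ≤ r) (k : ℕ) :
    PsiSV B p τ1 τ2 k t r ≤ (b ^ k) ^ ((r - q) + (t - s)) * PsiSV B p τ1 τ2 k s q := by
  unfold PsiSV
  rw [Finset.mul_sum]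
  refine Finset.sum_le_sum fun f _ => ?_
  have := psi_mono B p τ1 τ2 hm hb hc hd hp h1a h2a hst hq hqr (List.ofFn f)
  rwa [List.length_ofFn] at this

theorem Psi_convex (hm : 0 < m) (hc : ∀ i, m ≤ B.c i ∧ B.c i ≤ b)
    (hd : ∀ i, m ≤ B.d i ∧ B.d i ≤ b) (hp : ∀ i, 0 < p i ∧ p i ≤ b)
    {q r s t x y : ℝ} (hx : 0 ≤ x) (hy : 0 ≤ y) (hxy : x + y = 1)
    (h1 : τ1 (x * q + y * r) ≤ x * τ1 q + y * τ1 r)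
    (h2 : τ2 (x * q + y * r) ≤ x * τ2 q + y * τ2 r) (k : ℕ) :
    PsiSV B p τ1 τ2 k (x * s + y * t) (x * q + y * r) ≤
      max (PsiSV B p τ1 τ2 k s q) (PsiSV B p τ1 τ2 k t r) := by
  have h : PsiSV B p τ1 τ2 k (x * s + y * t) (x * q + y * r) ≤
      x * PsiSV B p τ1 τ2 k s q + y * PsiSV B p τ1 τ2 k t r := by
    unfold PsiSV
    rw [Finset.mul_sum, Finset.mul_sum, ← Finset.sum_add_distrib]
    exact Finset.sum_le_sum fun f _ => psi_convex B p τ1 τ2 hm hc hd hp hx hy hxy h1 h2 _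
  refine h.trans ?_
  have a1 := mul_le_mul_of_nonneg_left
    (le_max_left (PsiSV B p τ1 τ2 k s q) (PsiSV B p τ1 τ2 k t r)) hx
  have a2 := mul_le_mul_of_nonneg_left
    (le_max_right (PsiSV B p τ1 τ2 k s q) (PsiSV B p τ1 τ2 k t r)) hy
  calc _ ≤ _ := add_le_add a1 a2
    _ = _ := by rw [← add_mul, hxy, one_mul]

theorem Psi_one (hm : 0 < m) (hc : ∀ i, m ≤ B.c i ∧ B.c i ≤ b)
    (hd : ∀ i, m ≤ B.d i ∧ B.d i ≤ b) (hpsum : ∑ i, p i = 1) (h1 : τ1 1 = 0) (h2 : τ2 1 = 0)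
    (k : ℕ) : PsiSV B p τ1 τ2 k 0 1 = 1 := by
  have e : ∀ f : Fin k → ι, psiSV B p τ1 τ2 0 1 (List.ofFn f) = ∏ j, p (f j) := by
    intro f
    rw [psi_eq B p τ1 τ2 hm hc hd]
    have : tauW B τ1 τ2 (List.ofFn f) 1 = 0 := by unfold tauW; split_ifs <;> assumption
    rw [this]
    simp [wordProb, List.map_ofFn, List.prod_ofFn]
  unfold PsiSV
  simp only [e]
  rw [← Fintype.sum_pow, hpsum, one_pow]

theorem Psi_le (hm : 0 < m) (hb : b < 1) (hc : ∀ i, m ≤ B.c i ∧ B.c i ≤ b)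
    (hd : ∀ i, m ≤ B.d i ∧ B.d i ≤ b) (hp : ∀ i, 0 < p i ∧ p i ≤ b) (hb0 : 0 ≤ b) {s q : ℝ} (hs : s ≤ 0)
    (hq : 0 ≤ q)
    (h1 : τ1 q ≤ 0) (h2 : τ2 q ≤ 0) (k : ℕ) :
    PsiSV B p τ1 τ2 k s q ≤ (Fintype.card ι * b ^ q * m ^ s) ^ k := by
  have e : ∀ f : Fin k → ι, psiSV B p τ1 τ2 s q (List.ofFn f) ≤ (b ^ k) ^ q * (m ^ k) ^ s := by
    intro f
    rw [psi_eq B p τ1 τ2 hm hc hd]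
    set l := List.ofFn f with hl
    have hlen : l.length = k := by simp [hl]
    have h := dims_bounds B hm hc hd l
    have h0 : 0 < m ^ l.length := by positivity
    have g2m : m ^ l.length ≤ B.alpha2 l := le_min h.1.1 h.2.1
    have g2 : 0 < B.alpha2 l := h0.trans_le g2m
    have g21 : B.alpha2 l ≤ B.alpha1 l := min_le_max
    have hw := wordProb_bounds hp l
    have hw0 := hw.1
    have hone : 1 ≤ B.alpha1 l / B.alpha2 l := (one_le_div g2).2 g21
    have hτ : tauW B τ1 τ2 l q ≤ 0 := by unfold tauW; split_ifs <;> assumption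
    have e3 := Real.rpow_le_one_of_one_le_of_nonpos hone hτ
    have e1 := Real.rpow_le_rpow hw.1.le hw.2 hq
    have e2 := Real.rpow_le_rpow_of_nonpos h0 g2m hs
    rw [hlen] at e1 e2
    have hbk : 0 < b ^ l.length := hw.1.trans_le hw.2
    rw [hlen] at hbk
    have p3 : 0 ≤ (B.alpha1 l / B.alpha2 l) ^ tauW B τ1 τ2 l q :=
      Real.rpow_nonneg (by linarith) _
    calc _ ≤ (b ^ k) ^ q * (m ^ k) ^ s * 1 := by
          apply mul_le_mul _ e3 p3 (by positivity)
          apply mul_le_mul e1 e2 (by positivity) (by positivity)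
      _ = _ := mul_one _
  unfold PsiSV
  refine (Finset.sum_le_card_nsmul _ _ _ (fun f _ => e f)).trans (le_of_eq ?_)
  rw [nsmul_eq_mul, mul_pow, mul_pow, ← Real.rpow_natCast_mul hb0, ← Real.rpow_natCast_mul hm.le,
    ← Real.rpow_mul_natCast hb0, ← Real.rpow_mul_natCast hm.le]
  simp [mul_comm]
  ring
end psi

theorem properties_of_gamma
    {ι : Type} [Fintype ι] [Nonempty ι] (hcard : 2 ≤ Fintype.card ι)
    (B : IFSData ι)
    (hc : ∀ i, B.c i ∈ Set.Ioo (0 : ℝ) 1) (hd : ∀ i, B.d i ∈ Set.Ioo (0 : ℝ) 1)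
    (p : ι → ℝ) (hp : ∀ i, p i ∈ Set.Ioo (0 : ℝ) 1) (hpsum : ∑ i : ι, p i = 1)
    (μ : Measure (ℝ × ℝ)) [IsProbabilityMeasure μ]
    (hcpt : ∃ K : Set (ℝ × ℝ), IsCompact K ∧ μ Kᶜ = 0)
    (hself : μ = ∑ i : ι, ENNReal.ofReal (p i) • Measure.map (B.S i) μ)
    (τ1 τ2 : ℝ → ℝ)
    (hτ1 : ∀ q : ℝ, 0 ≤ q → IsLqSpec (Measure.map Prod.fst μ) q (τ1 q))
    (hτ2 : ∀ q : ℝ, 0 ≤ q → IsLqSpec (Measure.map Prod.snd μ) q (τ2 q))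
    (P : ℝ → ℝ → ℝ)
    (hP : ∀ s q : ℝ, 0 ≤ q →
      Tendsto (fun k : ℕ => PsiSV B p τ1 τ2 k s q ^ ((k : ℝ)⁻¹)) atTop (nhds (P s q)))
    (γ : ℝ → ℝ) (hγ : ∀ q : ℝ, 0 ≤ q → P (γ q) q = 1)
    (γks : ℕ → ℝ → ℝ)
    (hγks : ∀ k : ℕ, 1 ≤ k → ∀ q : ℝ, 0 ≤ q → PsiSV B p τ1 τ2 k (γks k q) q = 1)
     :
    StrictAntiOn γ (Set.Ici 0) ∧
    ContinuousOn γ (Set.Ioi 0) ∧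
    (∀ q : ℝ, 0 ≤ q → Tendsto (fun k : ℕ => γks k q) atTop (nhds (γ q))) ∧
    (γ 1 = 0 ∧ Tendsto γ atTop atBot) ∧
    ConvexOn ℝ (Set.Ioi 0) γ := by
  obtain ⟨m, b, hm, hb0, hb1, hcB, hdB, hpB⟩ : ∃ m b : ℝ, 0 < m ∧ 0 < b ∧ b < 1 ∧
      (∀ i, m ≤ B.c i ∧ B.c i ≤ b) ∧ (∀ i, m ≤ B.d i ∧ B.d i ≤ b) ∧ (∀ i, 0 < p i ∧ p i ≤ b) := by
    refine ⟨alphaMin B, max (alphaMax B) (pMax p), ?_, ?_, ?_, fun i => ⟨?_, ?_⟩,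
      fun i => ⟨?_, ?_⟩, fun i => ⟨(hp i).1, ?_⟩⟩
    · rw [alphaMin, Finset.lt_inf'_iff]
      exact fun i _ => lt_min (hc i).1 (hd i).1
    · have i : ι := Classical.arbitrary ι
      refine lt_max_of_lt_right ?_
      rw [pMax, Finset.lt_sup'_iff]
      exact ⟨i, Finset.mem_univ i, (hp i).1⟩
    · rw [max_lt_iff, alphaMax, pMax, Finset.sup'_lt_iff, Finset.sup'_lt_iff]
      exact ⟨fun i _ => max_lt (hc i).2 (hd i).2, fun i _ => (hp i).2⟩
    · exact (Finset.inf'_le _ (Finset.mem_univ i)).trans (min_le_left _ _)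
    · exact le_max_of_le_left ((le_max_left (B.c i) (B.d i)).trans
        (Finset.le_sup' (fun i => max (B.c i) (B.d i)) (Finset.mem_univ i)))
    · exact (Finset.inf'_le _ (Finset.mem_univ i)).trans (min_le_right _ _)
    · exact le_max_of_le_left ((le_max_right (B.c i) (B.d i)).trans
        (Finset.le_sup' (fun i => max (B.c i) (B.d i)) (Finset.mem_univ i)))
    · exact le_max_of_le_right (Finset.le_sup' p (Finset.mem_univ i))
  -- the spectra of the projections
  obtain ⟨R, hR0, hRμ⟩ : ∃ R : ℝ, 0 ≤ R ∧ ∀ᵐ x ∂μ, |x.1| ≤ R ∧ |x.2| ≤ R := by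
    obtain ⟨K, hK, hK0⟩ := hcpt
    obtain ⟨R, hR⟩ := hK.isBounded.exists_norm_le
    refine ⟨max R 0, le_max_right _ _, ?_⟩
    have hae : ∀ᵐ x ∂μ, x ∈ K := by rw [ae_iff]; exact hK0
    filter_upwards [hae] with x hx
    have h := hR x hx
    exact ⟨le_max_of_le_left ((norm_fst_le x).trans h), le_max_of_le_left ((norm_snd_le x).trans h)⟩
  have hmabs : MeasurableSet {x : ℝ | |x| ≤ R} :=
    (isClosed_le continuous_abs continuous_const).measurableSet
  have : IsProbabilityMeasure (Measure.map Prod.fst μ) :=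
    Measure.isProbabilityMeasure_map measurable_fst.aemeasurable
  have : IsProbabilityMeasure (Measure.map Prod.snd μ) :=
    Measure.isProbabilityMeasure_map measurable_snd.aemeasurable
  obtain ⟨h1o, h1a, h1c⟩ := lq_props (Measure.map Prod.fst μ) hR0
    ((ae_map_iff measurable_fst.aemeasurable hmabs).2 (hRμ.mono fun _ h => h.1)) τ1 hτ1
  obtain ⟨h2o, h2a, h2c⟩ := lq_props (Measure.map Prod.snd μ) hR0
    ((ae_map_iff measurable_snd.aemeasurable hmabs).2 (hRμ.mono fun _ h => h.2)) τ2 hτ2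
  have hΨ : ∀ k s q, 0 < PsiSV B p τ1 τ2 k s q := Psi_pos B p τ1 τ2 hm hcB hdB hpB
  -- monotonicity of the pressure
  have hPm : ∀ s t q r : ℝ, s ≤ t → 0 ≤ q → q ≤ r →
      P t r ≤ b ^ ((r - q) + (t - s)) * P s q := by
    intro s t q r hst hq hqr
    refine le_of_tendsto_of_tendsto (hP t r (hq.trans hqr)) ((hP s q hq).const_mul _) ?_
    filter_upwards [eventually_ge_atTop 1] with k hk
    have hk0 : (k : ℝ) ≠ 0 := by positivity
    have h := Psi_mono B p τ1 τ2 hm hb1 hcB hdB hpB h1a h2a hst hq hqr k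
    refine (Real.rpow_le_rpow (hΨ k t r).le h (by positivity)).trans (le_of_eq ?_)
    rw [Real.mul_rpow (by positivity) (hΨ k s q).le, ← Real.rpow_mul (by positivity),
      ← Real.rpow_natCast_mul hb0.le]
    congr 2
    field_simp
  have hlt : ∀ e : ℝ, 0 < e → b ^ e < 1 := fun e he => Real.rpow_lt_one hb0.le hb1 he
  have hconv : ConvexOn ℝ (Set.Ioi 0) γ := by
    refine ⟨convex_Ioi 0, ?_⟩
    intro q hq r hr x y hx hy hxy
    simp only [smul_eq_mul]
    have hq : 0 < q := hq
    have hr : 0 < r := hr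
    have hqr : 0 ≤ x * q + y * r := by positivity
    by_contra! hcon
    have h1 := hPm _ _ _ _ hcon.le hqr le_rfl
    rw [hγ _ hqr] at h1
    have h2 : P (x * γ q + y * γ r) (x * q + y * r) ≤ 1 := by
      have hT := (hP (γ q) q hq.le).max (hP (γ r) r hr.le)
      rw [hγ q hq.le, hγ r hr.le, max_self] at hT
      refine le_of_tendsto_of_tendsto (hP _ _ hqr) hT ?_
      refine Eventually.of_forall fun k => ?_
      have h := Psi_convex B p τ1 τ2 hm hcB hdB hpB (s := γ q) (t := γ r) hx hy hxy
        (h1c q r x y hq.le hr.le hx hy hxy) (h2c q r x y hq.le hr.le hx hy hxy) k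
      rcases le_max_iff.1 h with h | h
      · exact le_max_of_le_left (Real.rpow_le_rpow (hΨ k _ _).le h (by positivity))
      · exact le_max_of_le_right (Real.rpow_le_rpow (hΨ k _ _).le h (by positivity))
    have h3 := hlt (x * q + y * r - (x * q + y * r) + (γ (x * q + y * r) - (x * γ q + y * γ r)))
      (by linarith)
    have h4 : 0 < b ^ (x * q + y * r - (x * q + y * r) +
      (γ (x * q + y * r) - (x * γ q + y * γ r))) := Real.rpow_pos_of_pos hb0 _
    nlinarith
  refine ⟨?_, hconv.continuousOn isOpen_Ioi, ?_, ⟨?_, ?_⟩, hconv⟩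
  · intro q hq r hr hqr
    have hq : 0 ≤ q := hq
    have hr : 0 ≤ r := hr
    by_contra! hcon
    have h1 := hPm _ _ _ _ hcon hq hqr.le
    rw [hγ q hq, hγ r hr, mul_one] at h1
    have := hlt (r - q + (γ r - γ q)) (by linarith)
    linarith
  · intro q hq
    have hanti : ∀ k : ℕ, ∀ s t : ℝ, s ≤ t → PsiSV B p τ1 τ2 k t q ≤ PsiSV B p τ1 τ2 k s q := by
      intro k s t hst
      have h := Psi_mono B p τ1 τ2 hm hb1 hcB hdB hpB h1a h2a hst hq le_rfl k
      have h2 : (b ^ k) ^ (q - q + (t - s)) ≤ 1 :=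
        Real.rpow_le_one (by positivity) (pow_le_one₀ hb0.le hb1.le) (by linarith)
      exact h.trans (mul_le_of_le_one_left (hΨ k s q).le h2)
    rw [tendsto_order]
    constructor
    · intro a ha
      have h1 := hPm _ _ q q ha.le hq le_rfl
      rw [hγ q hq] at h1
      have h3 := hlt (q - q + (γ q - a)) (by linarith)
      have h4 : 0 < b ^ (q - q + (γ q - a)) := Real.rpow_pos_of_pos hb0 _
      have h5 : 1 < P a q := by
        by_contra! hcon
        nlinarith
      filter_upwards [(hP a q hq).eventually (lt_mem_nhds h5), eventually_ge_atTop 1] with k hk hk1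
      by_contra! hcon
      have h6 := hanti k _ _ hcon
      rw [hγks k hk1 q hq] at h6
      have := Real.rpow_le_one (hΨ k a q).le h6 (by positivity : (0:ℝ) ≤ (k : ℝ)⁻¹)
      linarith
    · intro a ha
      have h1 := hPm _ _ q q ha.le hq le_rfl
      rw [hγ q hq, mul_one] at h1
      have h3 := hlt (q - q + (a - γ q)) (by linarith)
      have h5 : P a q < 1 := by linarith
      filter_upwards [(hP a q hq).eventually (gt_mem_nhds h5), eventually_ge_atTop 1] with k hk hk1
      by_contra! hcon
      have h6 := hanti k _ _ hcon
      rw [hγks k hk1 q hq] at h6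
      have := Real.one_le_rpow h6 (by positivity : (0:ℝ) ≤ (k : ℝ)⁻¹)
      linarith
  · have hP01 : P 0 1 = 1 := by
      refine tendsto_nhds_unique (hP 0 1 zero_le_one) ?_
      simp only [Psi_one B p τ1 τ2 hm hcB hdB hpsum h1o h2o, Real.one_rpow]
      exact tendsto_const_nhds
    rcases lt_trichotomy (γ 1) 0 with h | h | h
    · have h1 := hPm _ _ 1 1 h.le zero_le_one le_rfl
      rw [hγ 1 zero_le_one, hP01, mul_one] at h1
      have := hlt (1 - 1 + (0 - γ 1)) (by linarith)
      linarith
    · exact h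
    · have h1 := hPm _ _ 1 1 h.le zero_le_one le_rfl
      rw [hγ 1 zero_le_one, hP01, mul_one] at h1
      have := hlt (1 - 1 + (γ 1 - 0)) (by linarith)
      linarith
  · rw [tendsto_atBot]
    intro s
    set s' := min s 0
    have hlim : Tendsto (fun q : ℝ => (Fintype.card ι : ℝ) * b ^ q * m ^ s') atTop (nhds 0) := by
      have h := tendsto_rpow_atTop_of_base_lt_one b (by linarith) hb1
      simpa using (h.const_mul (Fintype.card ι : ℝ)).mul_const (m ^ s')
    filter_upwards [hlim.eventually (gt_mem_nhds zero_lt_one), eventually_ge_atTop 1] with q hq hq1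
    have hq0 : 0 ≤ q := by linarith
    have hPle : P s' q ≤ (Fintype.card ι : ℝ) * b ^ q * m ^ s' := by
      refine le_of_tendsto (hP s' q hq0) ?_
      filter_upwards [eventually_ge_atTop 1] with k hk
      have h := Psi_le B p τ1 τ2 hm hb1 hcB hdB hpB hb0.le (s := s') (min_le_right _ _) hq0
        (h1o ▸ h1a 1 q zero_le_one hq1) (h2o ▸ h2a 1 q zero_le_one hq1) k
      refine (Real.rpow_le_rpow (hΨ k _ _).le h (by positivity)).trans (le_of_eq ?_)
      exact Real.pow_rpow_inv_natCast (by positivity) (by omega)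
    refine le_trans ?_ (min_le_left s 0)
    by_contra! hcon
    have h1 := hPm _ _ q q hcon.le hq0 le_rfl
    rw [hγ q hq0] at h1
    have h3 := hlt (q - q + (γ q - s')) (by linarith)
    have h4 : 0 < b ^ (q - q + (γ q - s')) := Real.rpow_pos_of_pos hb0 _
    have h5 : P s' q < 1 := hPle.trans_lt hq
    nlinarith
end
end

section
/- Let μ be a box-like self-affine measure. For every q ∈ [0,1], the upper L^q-spectrum of μ satisfies τ̄_μ(q) ≤ γ(q). -/
open MeasureTheory Filter Set

attribute [local instance] Classical.propDecidable

noncomputable section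

/-! ### The moment integral, in `ℝ≥0∞` -/

section Moments

variable {X : Type*} [MeasurableSpace X] [PseudoMetricSpace X]

/-- `∫⁻ ν(B(x,δ))^(q-1) dν(x)`. -/
def momZ (ν : Measure X) (q δ : ℝ) : ENNReal :=
  ∫⁻ x, ν (Metric.ball x δ) ^ (q - 1) ∂ν

lemma ennrpow_anti {x y : ENNReal} {z : ℝ} (h : x ≤ y) (hz : z ≤ 0) : y ^ z ≤ x ^ z := by
  have h1 : x ^ (-z) ≤ y ^ (-z) := ENNReal.rpow_le_rpow h (by linarith)
  have := ENNReal.inv_le_inv.2 h1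
  rwa [← ENNReal.rpow_neg, ← ENNReal.rpow_neg, neg_neg] at this

lemma momZ_anti (ν : Measure X) {q : ℝ} (hq : q ≤ 1) {δ r : ℝ} (h : δ ≤ r) :
    momZ ν q r ≤ momZ ν q δ :=
  lintegral_mono fun _ => ennrpow_anti (measure_mono (Metric.ball_subset_ball h)) (by linarith)

lemma one_le_momZ (ν : Measure X) [IsProbabilityMeasure ν] {q : ℝ} (hq : q ≤ 1) (δ : ℝ) :
    1 ≤ momZ ν q δ := by
  have : ∫⁻ _ : X, 1 ∂ν = 1 := by simp
  rw [← this]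
  refine lintegral_mono fun x => ?_
  have := ennrpow_anti (x := ν (Metric.ball x δ)) (y := 1) (z := q - 1) prob_le_one (by linarith)
  simpa using this

lemma measurable_ball_meas [OpensMeasurableSpace X] [SecondCountableTopology X]
    (ν : Measure X) [SFinite ν] (δ : ℝ) :
    Measurable fun x => ν (Metric.ball x δ) := by
  have ho : IsOpen {z : X × X | dist z.2 z.1 < δ} :=
    isOpen_lt (by fun_prop) continuous_const
  exact measurable_measure_prodMk_left (ν := ν) ho.measurableSet

lemma integral_eq_momZ [OpensMeasurableSpace X] [SecondCountableTopology X]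
    (ν : Measure X) [SFinite ν] {q δ : ℝ} (h : momZ ν q δ ≠ ⊤) :
    ∫ x, (ν (Metric.ball x δ)).toReal ^ (q - 1) ∂ν = (momZ ν q δ).toReal := by
  have hm : Measurable fun x => ν (Metric.ball x δ) ^ (q - 1) :=
    (measurable_ball_meas ν δ).pow_const _
  rw [momZ, ← integral_toReal hm.aemeasurable (ae_lt_top hm h)]
  simp only [ENNReal.toReal_rpow]

lemma momZ_split {ι : Type*} [Fintype ι] (ν : Measure X) (νi : ι → Measure X)
    [∀ i, IsFiniteMeasure (νi i)] (p : ι → ℝ) (hp : ∀ i, 0 < p i)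
    (h : ν = ∑ i, ENNReal.ofReal (p i) • νi i) {q : ℝ} (hq : q ≤ 1) (δ : ℝ) :
    momZ ν q δ ≤ ∑ i, ENNReal.ofReal (p i) ^ q * momZ (νi i) q δ := by
  have hle : ∀ i s, ENNReal.ofReal (p i) * νi i s ≤ ν s := by
    intro i s
    rw [h, Measure.finsetSum_apply]
    exact Finset.single_le_sum (f := fun i => (ENNReal.ofReal (p i) • νi i) s)
      (fun _ _ => zero_le) (Finset.mem_univ i)
  have h1 : momZ ν q δ
      = ∑ i, ENNReal.ofReal (p i) * ∫⁻ x, ν (Metric.ball x δ) ^ (q - 1) ∂(νi i) := by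
    unfold momZ
    conv_lhs => enter [1]; rw [h]
    rw [lintegral_finsetSum_measure]
    simp [lintegral_smul_measure]
  rw [h1]
  refine Finset.sum_le_sum fun i _ => ?_
  have hp0 : ENNReal.ofReal (p i) ≠ 0 := by simpa using hp i
  have hpt : ENNReal.ofReal (p i) ≠ ⊤ := ENNReal.ofReal_ne_top
  have h2 : ENNReal.ofReal (p i) ^ q
      = ENNReal.ofReal (p i) * ENNReal.ofReal (p i) ^ (q - 1) := by
    conv_rhs => enter [1]; rw [← ENNReal.rpow_one (ENNReal.ofReal (p i))]
    rw [← ENNReal.rpow_add _ _ hp0 hpt]; congr 1; ring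
  rw [h2, mul_assoc]
  gcongr
  unfold momZ
  rw [← lintegral_const_mul' _ _ (by simp [ENNReal.rpow_eq_top_iff, hpt, hp i])]
  refine lintegral_mono fun x => ?_
  rw [← ENNReal.mul_rpow_of_ne_top hpt (measure_ne_top _ _)]
  exact ennrpow_anti (hle i _) (by linarith)

end Moments

/-- Crude bound for measures on a bounded interval. -/
lemma momZ_real_le (ν : Measure ℝ) [IsProbabilityMeasure ν] {R : ℝ} (hR : 0 ≤ R)
    (hν : ν (Icc (-R) R)ᶜ = 0) {q : ℝ} (hq0 : 0 ≤ q) (hq : q ≤ 1) {δ : ℝ} (hδ : 0 < δ) :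
    momZ ν q δ ≤ ENNReal.ofReal (2 * R / δ + 2) := by
  set Q : ℤ → Set ℝ := fun j => (fun x : ℝ => ⌊x / δ⌋) ⁻¹' {j} with hQ
  have hQm : ∀ j, MeasurableSet (Q j) := fun j => by
    have : Measurable fun x : ℝ => ⌊x / δ⌋ := Int.measurable_floor.comp (by fun_prop)
    exact this (measurableSet_singleton j)
  have hQi : ∀ j, ∫⁻ x in Q j, ν (Metric.ball x δ) ^ (q - 1) ∂ν ≤ 1 := by
    intro j
    have hb : ∀ x ∈ Q j, ν (Metric.ball x δ) ^ (q - 1) ≤ ν (Q j) ^ (q - 1) := by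
      intro x hx
      refine ennrpow_anti (measure_mono fun y hy => ?_) (by linarith)
      have hx' : ⌊x / δ⌋ = j := hx
      have hy' : ⌊y / δ⌋ = j := hy
      have h := Int.abs_sub_lt_one_of_floor_eq_floor (hy'.trans hx'.symm)
      rw [Metric.mem_ball, Real.dist_eq]
      rw [← sub_div, abs_div, abs_of_pos hδ, div_lt_one hδ] at h
      exact h
    calc ∫⁻ x in Q j, ν (Metric.ball x δ) ^ (q - 1) ∂ν
        ≤ ∫⁻ x in Q j, ν (Q j) ^ (q - 1) ∂ν := setLIntegral_mono' (hQm j) hb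
      _ = ν (Q j) ^ (q - 1) * ν (Q j) := by simp
      _ ≤ 1 := by
        by_cases h0 : ν (Q j) = 0
        · simp [h0]
        · have ht : ν (Q j) ≠ ⊤ := measure_ne_top _ _
          conv_lhs => enter [2]; rw [← ENNReal.rpow_one (ν (Q j))]
          rw [← ENNReal.rpow_add _ _ h0 ht, sub_add_cancel]
          exact ENNReal.rpow_le_one prob_le_one hq0
  set J : Finset ℤ := Finset.Icc ⌊-R / δ⌋ ⌊R / δ⌋ with hJ
  have hcov : Icc (-R) R ⊆ ⋃ j ∈ J, Q j := by
    intro x hx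
    simp only [mem_iUnion]
    refine ⟨⌊x / δ⌋, ?_, rfl⟩
    rw [hJ, Finset.mem_Icc]
    exact ⟨Int.floor_le_floor (by gcongr; exact hx.1), Int.floor_le_floor (by gcongr; exact hx.2)⟩
  have hae : ν.restrict (⋃ j ∈ J, Q j) = ν := by
    rw [Measure.restrict_eq_self_of_ae_mem]
    have : ∀ᵐ x ∂ν, x ∈ Icc (-R) R := by
      rw [ae_iff]; exact hν
    exact this.mono fun x hx => hcov hx
  have h1 : momZ ν q δ ≤ J.card := by
    unfold momZ
    conv_lhs => enter [1]; rw [← hae]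
    rw [lintegral_biUnion_finset _ (fun b _ => hQm b)]
    · calc _ ≤ ∑ j ∈ J, (1 : ENNReal) := Finset.sum_le_sum fun j _ => hQi j
        _ = J.card := by simp
    · intro a _ b _ hab
      refine Set.disjoint_left.2 fun x hxa hxb => hab ?_
      exact (show ⌊x / δ⌋ = a from hxa).symm.trans hxb
  refine h1.trans ?_
  rw [← ENNReal.ofReal_natCast]
  apply ENNReal.ofReal_le_ofReal
  have hle : ⌊-R / δ⌋ ≤ ⌊R / δ⌋ := Int.floor_le_floor (by gcongr; linarith)
  rw [hJ, Int.card_Icc]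
  have : (((⌊R / δ⌋ + 1 - ⌊-R / δ⌋).toNat : ℤ) : ℝ) = ((⌊R / δ⌋ + 1 - ⌊-R / δ⌋ : ℤ) : ℝ) := by
    rw [Int.toNat_of_nonneg (by omega)]
  rw [Int.cast_natCast] at this
  rw [this]; push_cast
  have h3 := Int.floor_le (R / δ)
  have h4 := Int.lt_floor_add_one (-R / δ)
  have h5 : -R / δ = -(R / δ) := by ring
  have h6 : 2 * R / δ = 2 * (R / δ) := by ring
  rw [h6]; linarith

/-- If the upper spectrum equals `t`, then the moments are bounded by `C r^(-t-ε)` on `(0, rmax]`. -/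
lemma momZ_le_of_spec (ν : Measure ℝ) [IsProbabilityMeasure ν] {R : ℝ} (hR : 0 ≤ R)
    (hν : ν (Icc (-R) R)ᶜ = 0) {q : ℝ} (hq0 : 0 ≤ q) (hq : q ≤ 1) {t : ℝ}
    (ht : upperLq ν q = t) {ε : ℝ} (hε : 0 < ε) (rmax : ℝ) :
    ∃ C : ℝ, 0 < C ∧ ∀ r, 0 < r → r ≤ rmax →
      momZ ν q r ≤ ENNReal.ofReal (C * r ^ (-t - ε)) := by
  have hfin : ∀ r, 0 < r → momZ ν q r ≠ ⊤ := fun r hr =>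
    ((momZ_real_le ν hR hν hq0 hq hr).trans_lt ENNReal.ofReal_lt_top).ne
  have hbd : IsBoundedUnder (· ≤ ·) (nhdsWithin 0 (Set.Ioi 0)) (fun δ : ℝ =>
      Real.log (∫ x, (ν (Metric.ball x δ)).toReal ^ (q - 1) ∂ν) / (-Real.log δ)) := by
    refine isBoundedUnder_of_eventually_le (a := 2) ?_
    have : (0:ℝ) < 1 / (2 * R + 2) := by positivity
    filter_upwards [Ioo_mem_nhdsGT this] with δ hδ
    have hδ0 := hδ.1
    have hR1 : 1 / (2 * R + 2) ≤ 1 := by rw [div_le_one (by positivity)]; linarith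
    have hδ1 : δ < 1 := hδ.2.trans_le hR1
    rw [integral_eq_momZ ν (hfin δ hδ0)]
    have hl : 0 < -Real.log δ := by have := Real.log_neg hδ0 hδ1; linarith
    rw [div_le_iff₀ hl]
    have h1 : 1 ≤ (momZ ν q δ).toReal := by
      have := ENNReal.toReal_mono (hfin δ hδ0) (one_le_momZ ν hq δ)
      simpa using this
    have h2 : (momZ ν q δ).toReal ≤ 2 * R / δ + 2 :=
      ENNReal.toReal_le_of_le_ofReal (by positivity) (momZ_real_le ν hR hν hq0 hq hδ0)
    have h3 : 2 * R / δ + 2 ≤ (δ ^ 2)⁻¹ := by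
      have h7 := hδ.2
      rw [lt_div_iff₀ (by positivity)] at h7
      rw [div_add' _ _ _ hδ0.ne', ← one_div, div_le_div_iff₀ hδ0 (by positivity)]
      nlinarith
    calc Real.log (momZ ν q δ).toReal ≤ Real.log ((δ ^ 2)⁻¹) :=
          Real.log_le_log (by linarith) (h2.trans h3)
      _ = 2 * -Real.log δ := by rw [Real.log_inv, Real.log_pow]; push_cast; ring
  have hev := eventually_lt_of_limsup_lt (b := t + ε) (by
    show upperLq ν q < t + ε
    linarith) hbd
  obtain ⟨r0, hr0, hr0'⟩ := mem_nhdsGT_iff_exists_Ioo_subset.1 hev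
  have hr0 : 0 < r0 := hr0
  set r1 := min r0 1 with hr1
  have hr1p : 0 < r1 := by positivity
  have hsmall : ∀ r, 0 < r → r < r1 → momZ ν q r ≤ ENNReal.ofReal (r ^ (-t - ε)) := by
    intro r hr hrr
    have h := hr0' ⟨hr, hrr.trans_le (min_le_left _ _)⟩
    have hrlt1 := hrr.trans_le (min_le_right _ _)
    simp only [Set.mem_ofPred_eq] at h
    rw [integral_eq_momZ ν (hfin r hr)] at h
    have hl : 0 < -Real.log r := by have := Real.log_neg hr hrlt1; linarith
    rw [div_lt_iff₀ hl] at h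
    have h1 : 1 ≤ (momZ ν q r).toReal := by
      have := ENNReal.toReal_mono (hfin r hr) (one_le_momZ ν hq r)
      simpa using this
    rw [← ENNReal.ofReal_toReal (hfin r hr)]
    apply ENNReal.ofReal_le_ofReal
    rw [Real.le_rpow_iff_log_le (by linarith) hr]
    linarith
  set a := -t - ε with ha
  set m := min ((r1 / 2) ^ a) (rmax ^ a) with hm
  by_cases hrm : rmax ≤ 0
  · exact ⟨1, one_pos, fun r h1 h2 => absurd (h1.trans_le h2) (not_lt.2 hrm)⟩
  push Not at hrm
  have hmpos : 0 < m := lt_min (by positivity) (by positivity)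
  set V := (momZ ν q (r1 / 2)).toReal with hV
  refine ⟨1 + V / m, by positivity, fun r hr hrmax => ?_⟩
  by_cases hrr : r < r1
  · refine (hsmall r hr hrr).trans (ENNReal.ofReal_le_ofReal ?_)
    have : 0 ≤ V / m * r ^ a := by positivity
    linarith
  · push Not at hrr
    have h1 := momZ_anti ν hq (show r1 / 2 ≤ r by linarith)
    refine h1.trans ?_
    rw [← ENNReal.ofReal_toReal (hfin (r1 / 2) (by positivity))]
    apply ENNReal.ofReal_le_ofReal
    have hmr : m ≤ r ^ a := by
      rcases le_total 0 a with h | h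
      · exact (min_le_left _ _).trans (Real.rpow_le_rpow (by positivity) (by linarith) h)
      · exact (min_le_right _ _).trans (Real.rpow_le_rpow_of_nonpos hr hrmax h)
    have : V = V / m * m := by field_simp
    have h2 : V / m * m ≤ V / m * r ^ a := by gcongr
    have h3 : 0 < r ^ a := by positivity
    rw [← hV]; linarith

/-! ### Words -/

namespace IFSData

variable {ι : Type}

lemma swapW_cons (B : IFSData ι) (i : ι) (l : List ι) :
    B.swapW (i :: l) = xor (B.swap i) (B.swapW l) := rfl

lemma dims_cons (B : IFSData ι) (i : ι) (l : List ι) : B.dims (i :: l) =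
    (B.c i * (if B.swap i then (B.dims l).2 else (B.dims l).1),
      B.d i * (if B.swap i then (B.dims l).1 else (B.dims l).2)) := rfl

lemma Sw_cons (B : IFSData ι) (i : ι) (l : List ι) : B.Sw (i :: l) = B.S i ∘ B.Sw l := rfl

lemma Sw_append (B : IFSData ι) (l : List ι) (i : ι) : B.Sw (l ++ [i]) = B.Sw l ∘ B.S i := by
  induction l with
  | nil => rfl
  | cons j l ih => rw [List.cons_append, Sw_cons, ih, Sw_cons]; rfl

lemma continuous_S (B : IFSData ι) (i : ι) : Continuous (B.S i) := by
  unfold S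
  cases B.swap i <;> cases B.sgn1 i <;> cases B.sgn2 i <;> simp <;> constructor <;> fun_prop

lemma continuous_Sw (B : IFSData ι) (l : List ι) : Continuous (B.Sw l) := by
  induction l with
  | nil => exact continuous_id
  | cons j l ih => exact (B.continuous_S j).comp ih

lemma dims_pos (B : IFSData ι) (hc : ∀ i, 0 < B.c i) (hd : ∀ i, 0 < B.d i) (l : List ι) :
    0 < (B.dims l).1 ∧ 0 < (B.dims l).2 := by
  induction l with
  | nil => simp [dims]
  | cons j l ih =>
    rw [dims_cons]
    have := hc j
    have := hd j
    obtain ⟨h1, h2⟩ := ih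
    cases B.swap j <;> simp <;> constructor <;> positivity

lemma dims_le (B : IFSData ι) (hc : ∀ i, 0 < B.c i) (hd : ∀ i, 0 < B.d i) {A : ℝ} (hA : 0 ≤ A)
    (hcA : ∀ i, B.c i ≤ A) (hdA : ∀ i, B.d i ≤ A) (l : List ι) :
    (B.dims l).1 ≤ A ^ l.length ∧ (B.dims l).2 ≤ A ^ l.length := by
  induction l with
  | nil => simp [dims]
  | cons j l ih =>
    rw [dims_cons, List.length_cons, pow_succ']
    obtain ⟨h1, h2⟩ := ih
    obtain ⟨h3, h4⟩ := B.dims_pos hc hd l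
    have := hc j
    have := hd j
    have := hcA j
    have := hdA j
    cases B.swap j <;> simp <;> constructor <;> gcongr

lemma dims_append_ge (B : IFSData ι) (hc : ∀ i, 0 < B.c i) (hd : ∀ i, 0 < B.d i) {a : ℝ}
    (hca : ∀ i, a ≤ B.c i) (hda : ∀ i, a ≤ B.d i) (l : List ι) (i : ι) :
    a * (B.dims l).1 ≤ (B.dims (l ++ [i])).1 ∧ a * (B.dims l).2 ≤ (B.dims (l ++ [i])).2 := by
  induction l with
  | nil => simp [dims]; exact ⟨hca i, hda i⟩
  | cons j l ih =>
    rw [List.cons_append, dims_cons, dims_cons]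
    obtain ⟨h1, h2⟩ := ih
    have := hc j
    have := hd j
    cases B.swap j <;> simp <;> constructor <;> rw [mul_left_comm] <;> gcongr

lemma Sw_dist (B : IFSData ι) (hc : ∀ i, 0 < B.c i) (hd : ∀ i, 0 < B.d i) (l : List ι)
    (z x : ℝ × ℝ) :
    |(B.Sw l z).1 - (B.Sw l x).1|
      = (B.dims l).1 * (if B.swapW l then |z.2 - x.2| else |z.1 - x.1|) ∧
    |(B.Sw l z).2 - (B.Sw l x).2|
      = (B.dims l).2 * (if B.swapW l then |z.1 - x.1| else |z.2 - x.2|) := by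
  induction l with
  | nil => simp [dims, Sw, swapW]
  | cons j l ih =>
    obtain ⟨h1, h2⟩ := ih
    have hcj := hc j
    have hdj := hd j
    have key : ∀ (b : Bool) (c u v t : ℝ), 0 < c →
        |(if b then 1 else -1) * (c * u) + t - ((if b then 1 else -1) * (c * v) + t)|
          = c * |u - v| := by
      intro b c u v t h
      have : (if b then (1:ℝ) else -1) * (c * u) + t - ((if b then 1 else -1) * (c * v) + t)
        = (if b then 1 else -1) * (c * (u - v)) := by ring
      rw [this, abs_mul, abs_mul, abs_of_pos h]
      cases b <;> simp
    rw [dims_cons, swapW_cons, Sw_cons]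
    simp only [Function.comp, S]
    rw [key _ _ _ _ _ hcj, key _ _ _ _ _ hdj]
    cases B.swap j <;> cases hs : B.swapW l <;> simp [hs] at h1 h2 ⊢ <;>
      rw [h1, h2] <;> constructor <;> ring

/-- A point whose long-side coordinate is close is mapped close. -/
lemma Sw_ball (B : IFSData ι) (hc : ∀ i, 0 < B.c i) (hd : ∀ i, 0 < B.d i) (l : List ι)
    {δ D : ℝ} (hD : 0 < D) (hl : B.alpha2 l < δ / D) (z x : ℝ × ℝ)
    (h1 : |z.1 - x.1| ≤ D) (h2 : |z.2 - x.2| ≤ D)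
    (h : |B.projW l z - B.projW l x| < δ / B.alpha1 l) :
    B.Sw l z ∈ Metric.ball (B.Sw l x) δ := by
  obtain ⟨e1, e2⟩ := B.Sw_dist hc hd l z x
  obtain ⟨hb, hh⟩ := B.dims_pos hc hd l
  have ha2 : 0 < B.alpha2 l := lt_min hb hh
  have ha1 : 0 < B.alpha1 l := lt_max_of_lt_left hb
  rw [lt_div_iff₀ hD] at hl
  rw [lt_div_iff₀ ha1] at h
  have key : ∀ u, u ≤ D → B.alpha2 l * u < δ := fun u hu =>
    (mul_le_mul_of_nonneg_left hu ha2.le).trans_lt hl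
  rw [Metric.mem_ball, Prod.dist_eq, Real.dist_eq, Real.dist_eq, e1, e2]
  have k1 := key _ h1
  have k2 := key _ h2
  unfold projW usesPi1 alpha1 at h
  unfold alpha2 at k1 k2
  rcases le_or_gt (B.dims l).2 (B.dims l).1 with hle | hlt
  · rw [min_eq_right hle] at k1 k2
    rw [max_eq_left hle] at h
    cases hs : B.swapW l <;> simp [hs, hle, not_lt.2 hle] at h ⊢ <;>
      constructor <;> linarith
  · rw [min_eq_left hlt.le] at k1 k2
    rw [max_eq_right hlt.le] at h
    cases hs : B.swapW l <;> simp [hs, hlt, not_le.2 hlt] at h ⊢ <;>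
      constructor <;> linarith

lemma continuous_projW (B : IFSData ι) (l : List ι) : Continuous (B.projW l) := by
  unfold projW; split_ifs <;> fun_prop

end IFSData

lemma wordProb_append {ι : Type} (p : ι → ℝ) (l : List ι) (i : ι) :
    wordProb p (l ++ [i]) = wordProb p l * p i := by
  simp [wordProb]

lemma wordProb_pos {ι : Type} (p : ι → ℝ) (hp : ∀ i, 0 < p i) (l : List ι) :
    0 < wordProb p l := by
  induction l with
  | nil => simp [wordProb]
  | cons j l ih => simpa [wordProb] using mul_pos (hp j) ih

/-- Moment of a stopped cylinder is dominated by the moment of the projection. -/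
lemma momZ_cyl {ι : Type} (B : IFSData ι) (hc : ∀ i, 0 < B.c i) (hd : ∀ i, 0 < B.d i)
    (μ : Measure (ℝ × ℝ)) [IsProbabilityMeasure μ] {R : ℝ}
    (hμ : ∀ᵐ x ∂μ, |x.1| ≤ R ∧ |x.2| ≤ R) {D δ : ℝ} (hD : 0 < D) (hDR : 2 * R ≤ D)
    (l : List ι) (hl : B.alpha2 l < δ / D) {q : ℝ} (hq : q ≤ 1) :
    momZ (μ.map (B.Sw l)) q δ ≤ momZ (μ.map (B.projW l)) q (δ / B.alpha1 l) := by
  have mS := (B.continuous_Sw l).measurable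
  have mP := (B.continuous_projW l).measurable
  have : IsProbabilityMeasure (μ.map (B.Sw l)) := Measure.isProbabilityMeasure_map mS.aemeasurable
  have : IsProbabilityMeasure (μ.map (B.projW l)) :=
    Measure.isProbabilityMeasure_map mP.aemeasurable
  unfold momZ
  rw [lintegral_map ((measurable_ball_meas _ δ).pow_const _) mS,
    lintegral_map ((measurable_ball_meas _ _).pow_const _) mP]
  refine lintegral_mono_ae ?_
  filter_upwards [hμ] with x hx
  refine ennrpow_anti ?_ (by linarith)
  rw [Measure.map_apply mS Metric.isOpen_ball.measurableSet,
    Measure.map_apply mP Metric.isOpen_ball.measurableSet]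
  refine measure_mono_ae ?_
  filter_upwards [hμ] with z hz hzx
  refine B.Sw_ball hc hd l hD hl z x ?_ ?_ ?_
  · have := abs_sub z.1 x.1; linarith [hx.1, hz.1]
  · have := abs_sub z.2 x.2; linarith [hx.2, hz.2]
  · have : B.projW l z ∈ Metric.ball (B.projW l x) (δ / B.alpha1 l) := hzx
    rwa [Metric.mem_ball, Real.dist_eq] at this

lemma map_Sw_split {ι : Type} [Fintype ι] (B : IFSData ι) (p : ι → ℝ)
    (μ : Measure (ℝ × ℝ))
    (hself : μ = ∑ i : ι, ENNReal.ofReal (p i) • Measure.map (B.S i) μ) (l : List ι) :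
    μ.map (B.Sw l) = ∑ i, ENNReal.ofReal (p i) • μ.map (B.Sw (l ++ [i])) := by
  conv_lhs => rw [hself]
  rw [Measure.map_finset_sum (B.continuous_Sw l).measurable.aemeasurable]
  refine Finset.sum_congr rfl fun i _ => ?_
  rw [Measure.map_smul, Measure.map_map (B.continuous_Sw l).measurable
    (B.continuous_S i).measurable, B.Sw_append]

lemma sum_words_succ {ι : Type} [Fintype ι] {M : Type*} [AddCommMonoid M] (k : ℕ)
    (g : List ι → M) :
    ∑ f : Fin (k + 1) → ι, g (List.ofFn f) = ∑ f : Fin k → ι, ∑ i, g (List.ofFn f ++ [i]) := by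
  rw [← (Fin.snocEquiv (fun _ => ι)).sum_comp, Fintype.sum_prod_type_right]
  refine Finset.sum_congr rfl fun f _ => Finset.sum_congr rfl fun i _ => ?_
  rw [List.ofFn_succ']
  simp [Fin.snocEquiv]

lemma scale_ineq {δ D a α₁ α₂ t s ε K : ℝ} (hδ : 0 < δ) (hD : 0 < D) (ha : 0 < a)
    (h2 : 0 < α₂) (h1 : 0 < α₁) (h11 : α₁ ≤ 1) (hε : 0 < ε)
    (hl : α₂ < δ / D) (hu : a * (δ / D) ≤ α₂)
    (hK1 : D ^ (s - t) ≤ K) (hK2 : (D / a) ^ (s - t) ≤ K) :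
    (δ / α₁) ^ (-t - ε) ≤ K * δ ^ (-s - ε) * (α₁ ^ t * α₂ ^ (s - t)) := by
  have e1 : (δ / α₁) ^ (-t - ε) = δ ^ (-s - ε) * δ ^ (s - t) * (α₁ ^ t * α₁ ^ ε) := by
    rw [Real.div_rpow hδ.le h1.le, ← Real.rpow_add hδ, ← Real.rpow_add h1,
      show -t - ε = -(t + ε) by ring, Real.rpow_neg h1.le, div_inv_eq_mul]
    congr 2; ring
  have e2 : α₁ ^ ε ≤ 1 := Real.rpow_le_one h1.le h11 hε.le
  have e3 : δ ^ (s - t) ≤ K * α₂ ^ (s - t) := by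
    have hdu : δ = δ / α₂ * α₂ := by field_simp
    rw [hdu, Real.mul_rpow (by positivity) h2.le]
    gcongr
    have hu1 : D ≤ δ / α₂ := by
      rw [lt_div_iff₀ hD] at hl
      rw [le_div_iff₀ h2]; linarith
    have hu2 : δ / α₂ ≤ D / a := by
      rw [← mul_div_assoc, div_le_iff₀ hD] at hu
      rw [div_le_div_iff₀ h2 ha]; linarith
    rcases le_total 0 (s - t) with h | h
    · exact (Real.rpow_le_rpow (by positivity) hu2 h).trans hK2
    · exact (Real.rpow_le_rpow_of_nonpos hD hu1 h).trans hK1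
  have p1 : 0 < δ ^ (-s - ε) := by positivity
  have p2 : 0 < α₁ ^ t := by positivity
  have p3 : 0 < α₁ ^ ε := by positivity
  have p4 : 0 < δ ^ (s - t) := by positivity
  have p5 : 0 < K := (Real.rpow_pos_of_pos hD _).trans_le hK1
  rw [e1]
  calc δ ^ (-s - ε) * δ ^ (s - t) * (α₁ ^ t * α₁ ^ ε)
      ≤ δ ^ (-s - ε) * (K * α₂ ^ (s - t)) * (α₁ ^ t * 1) := by gcongr
    _ = _ := by ring

/-- Breadth-first decomposition of the moment of `μ` along the stopping. -/
lemma momZ_decomp {ι : Type} [Fintype ι] (B : IFSData ι) (p : ι → ℝ) (hp : ∀ i, 0 < p i)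
    (μ : Measure (ℝ × ℝ)) [IsProbabilityMeasure μ]
    (hself : μ = ∑ i : ι, ENNReal.ofReal (p i) • Measure.map (B.S i) μ)
    {q : ℝ} (hq0 : 0 ≤ q) (hq : q ≤ 1) (δ ρ : ℝ) (hρ : ρ ≤ 1) (G : List ι → ENNReal)
    (hG : ∀ l i, ρ ≤ B.alpha2 l → B.alpha2 (l ++ [i]) < ρ →
      ENNReal.ofReal (wordProb p (l ++ [i])) ^ q * momZ (μ.map (B.Sw (l ++ [i]))) q δ
        ≤ G (l ++ [i])) (k : ℕ) :
    momZ μ q δ ≤ (∑ f : Fin k → ι, if ρ ≤ B.alpha2 (List.ofFn f) then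
        ENNReal.ofReal (wordProb p (List.ofFn f)) ^ q * momZ (μ.map (B.Sw (List.ofFn f))) q δ
        else 0) + ∑ j ∈ Finset.range (k + 1), ∑ f : Fin j → ι, G (List.ofFn f) := by
  induction k with
  | zero =>
    have h1 : ρ ≤ B.alpha2 [] := by simpa [IFSData.alpha2, IFSData.dims] using hρ
    refine le_trans ?_ le_self_add
    simp [h1, wordProb, IFSData.Sw]
  | succ k ih =>
    refine ih.trans ?_
    rw [Finset.sum_range_succ _ (k + 1), add_comm _ (∑ f : Fin (k + 1) → ι, G (List.ofFn f)),
      ← add_assoc]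
    gcongr
    rw [sum_words_succ k (fun l => if ρ ≤ B.alpha2 l then
        ENNReal.ofReal (wordProb p l) ^ q * momZ (μ.map (B.Sw l)) q δ else 0),
      sum_words_succ k G, ← Finset.sum_add_distrib]
    refine Finset.sum_le_sum fun f _ => ?_
    split_ifs with hf
    swap
    · exact zero_le
    have : ∀ l, IsProbabilityMeasure (μ.map (B.Sw l)) := fun l =>
      Measure.isProbabilityMeasure_map (B.continuous_Sw l).measurable.aemeasurable
    have h1 := momZ_split _ _ p hp (map_Sw_split B p μ hself (List.ofFn f)) hq δ
    rw [← Finset.sum_add_distrib]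
    refine (mul_le_mul_right h1 _).trans ?_
    rw [Finset.mul_sum]
    refine Finset.sum_le_sum fun i _ => ?_
    rw [← mul_assoc, ← ENNReal.mul_rpow_of_nonneg _ _ hq0,
      ← ENNReal.ofReal_mul (wordProb_pos p hp _).le, ← wordProb_append]
    by_cases h : ρ ≤ B.alpha2 (List.ofFn f ++ [i])
    · rw [if_pos h]; exact le_self_add
    · rw [if_neg h, zero_add]; exact hG _ _ hf (not_le.1 h)

lemma psiSV_nonneg {ι : Type} (B : IFSData ι) (hc : ∀ i, 0 < B.c i) (hd : ∀ i, 0 < B.d i)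
    (p : ι → ℝ) (hp : ∀ i, 0 < p i) (τ1 τ2 : ℝ → ℝ) (s q : ℝ) (l : List ι) :
    0 ≤ psiSV B p τ1 τ2 s q l := by
  obtain ⟨hb, hh⟩ := B.dims_pos hc hd l
  have ha2 : 0 < B.alpha2 l := lt_min hb hh
  have ha1 : 0 < B.alpha1 l := lt_max_of_lt_left hb
  have := wordProb_pos p hp l
  unfold psiSV; positivity

/-- Summability of `Ψ_k^{s,q}` for `s = g + ε`, where `P(g,q) = 1`. -/
lemma summable_Psi {ι : Type} [Fintype ι] (B : IFSData ι) (hc : ∀ i, 0 < B.c i)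
    (hd : ∀ i, 0 < B.d i) (p : ι → ℝ) (hp : ∀ i, 0 < p i) (τ1 τ2 : ℝ → ℝ) {A : ℝ} (hA : 0 < A)
    (hA1 : A < 1) (hcA : ∀ i, B.c i ≤ A) (hdA : ∀ i, B.d i ≤ A) {g q ε : ℝ} (hε : 0 < ε)
    (hP : Tendsto (fun k : ℕ => PsiSV B p τ1 τ2 k g q ^ ((k : ℝ)⁻¹)) atTop (nhds 1)) :
    Summable fun k => PsiSV B p τ1 τ2 k (g + ε) q := by
  have hnn : ∀ s k, 0 ≤ PsiSV B p τ1 τ2 k s q := fun s k =>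
    Finset.sum_nonneg fun f _ => psiSV_nonneg B hc hd p hp τ1 τ2 s q _
  have hle : ∀ k, PsiSV B p τ1 τ2 k (g + ε) q ≤ (A ^ ε) ^ k * PsiSV B p τ1 τ2 k g q := by
    intro k
    unfold PsiSV
    rw [Finset.mul_sum]
    refine Finset.sum_le_sum fun f _ => ?_
    set l := List.ofFn f with hl
    obtain ⟨hb, hh⟩ := B.dims_pos hc hd l
    have ha2 : 0 < B.alpha2 l := lt_min hb hh
    have ha1 : 0 < B.alpha1 l := lt_max_of_lt_left hb
    have hw := wordProb_pos p hp l
    have h1 : B.alpha2 l ≤ A ^ k := by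
      have := (B.dims_le hc hd hA.le hcA hdA l).1
      rw [hl, List.length_ofFn] at this
      exact (min_le_left _ _).trans this
    have h2 : B.alpha2 l ^ ε ≤ (A ^ ε) ^ k := by
      refine (Real.rpow_le_rpow ha2.le h1 hε.le).trans_eq ?_
      rw [← Real.rpow_natCast, ← Real.rpow_natCast, ← Real.rpow_mul hA.le, ← Real.rpow_mul hA.le,
        mul_comm]
    have h3 : psiSV B p τ1 τ2 (g + ε) q l = B.alpha2 l ^ ε * psiSV B p τ1 τ2 g q l := by
      unfold psiSV
      rw [show g + ε - tauW B τ1 τ2 l q = ε + (g - tauW B τ1 τ2 l q) by ring, Real.rpow_add ha2]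
      ring
    rw [h3]
    exact mul_le_mul_of_nonneg_right h2 (psiSV_nonneg B hc hd p hp τ1 τ2 g q l)
  have hA2 : A ^ (ε / 2) < 1 := Real.rpow_lt_one hA.le hA1 (by linarith)
  have hA2p : 0 < A ^ (ε / 2) := by positivity
  have hev : ∀ᶠ k : ℕ in atTop, PsiSV B p τ1 τ2 k g q ≤ ((A ^ (ε / 2))⁻¹) ^ k := by
    have h1 : (1 : ℝ) < (A ^ (ε / 2))⁻¹ := (one_lt_inv₀ hA2p).2 hA2
    filter_upwards [hP.eventually (gt_mem_nhds h1), eventually_gt_atTop 0] with k hk hk0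
    have := pow_le_pow_left₀ (Real.rpow_nonneg (hnn g k) _) hk.le k
    rwa [Real.rpow_inv_natCast_pow (hnn g k) hk0.ne'] at this
  refine summable_of_isBigO_nat (summable_geometric_of_lt_one hA2p.le hA2) ?_
  refine Asymptotics.IsBigO.of_bound 1 ?_
  filter_upwards [hev] with k hk
  rw [Real.norm_of_nonneg (hnn _ _), Real.norm_of_nonneg (by positivity), one_mul]
  calc _ ≤ (A ^ ε) ^ k * ((A ^ (ε / 2))⁻¹) ^ k := (hle k).trans (by gcongr)
    _ = (A ^ (ε / 2)) ^ k := by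
      rw [← mul_pow]; congr 1
      rw [show A ^ ε = A ^ (ε / 2) * A ^ (ε / 2) by rw [← Real.rpow_add hA]; congr 1; ring]
      field_simp

theorem upper_lq_spectrum_le_gamma
    {ι : Type} [Fintype ι] [Nonempty ι] (hcard : 2 ≤ Fintype.card ι)
    (B : IFSData ι)
    (hc : ∀ i, B.c i ∈ Set.Ioo (0 : ℝ) 1) (hd : ∀ i, B.d i ∈ Set.Ioo (0 : ℝ) 1)
    (p : ι → ℝ) (hp : ∀ i, p i ∈ Set.Ioo (0 : ℝ) 1) (hpsum : ∑ i : ι, p i = 1)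
    (μ : Measure (ℝ × ℝ)) [IsProbabilityMeasure μ]
    (hcpt : ∃ K : Set (ℝ × ℝ), IsCompact K ∧ μ Kᶜ = 0)
    (hself : μ = ∑ i : ι, ENNReal.ofReal (p i) • Measure.map (B.S i) μ)
    (τ1 τ2 : ℝ → ℝ)
    (hτ1 : ∀ q : ℝ, 0 ≤ q → IsLqSpec (Measure.map Prod.fst μ) q (τ1 q))
    (hτ2 : ∀ q : ℝ, 0 ≤ q → IsLqSpec (Measure.map Prod.snd μ) q (τ2 q))
    (P : ℝ → ℝ → ℝ)
    (hP : ∀ s q : ℝ, 0 ≤ q →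
      Tendsto (fun k : ℕ => PsiSV B p τ1 τ2 k s q ^ ((k : ℝ)⁻¹)) atTop (nhds (P s q)))
    (γ : ℝ → ℝ) (hγ : ∀ q : ℝ, 0 ≤ q → P (γ q) q = 1)
     :
    ∀ q : ℝ, q ∈ Set.Icc (0 : ℝ) 1 → upperLq μ q ≤ γ q := by
  intro q hq
  obtain ⟨hq0, hq1⟩ := hq
  have hc0 : ∀ i, 0 < B.c i := fun i => (hc i).1
  have hd0 : ∀ i, 0 < B.d i := fun i => (hd i).1
  have hp0 : ∀ i, 0 < p i := fun i => (hp i).1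
  -- contraction bounds
  obtain ⟨A, hA, hA1, hcA, hdA⟩ :
      ∃ A : ℝ, 0 < A ∧ A < 1 ∧ (∀ i, B.c i ≤ A) ∧ (∀ i, B.d i ≤ A) := by
    obtain ⟨i, hi⟩ := Finite.exists_max fun i => max (B.c i) (B.d i)
    exact ⟨max (B.c i) (B.d i), lt_max_of_lt_left (hc0 i), max_lt (hc i).2 (hd i).2,
      fun j => (le_max_left _ _).trans (hi j), fun j => (le_max_right _ _).trans (hi j)⟩
  obtain ⟨a, ha, hca, hda⟩ :
      ∃ a : ℝ, 0 < a ∧ (∀ i, a ≤ B.c i) ∧ (∀ i, a ≤ B.d i) := by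
    obtain ⟨i, hi⟩ := Finite.exists_min fun i => min (B.c i) (B.d i)
    exact ⟨min (B.c i) (B.d i), lt_min (hc0 i) (hd0 i),
      fun j => (hi j).trans (min_le_left _ _), fun j => (hi j).trans (min_le_right _ _)⟩
  -- compact support
  obtain ⟨R, hR, hμ⟩ : ∃ R : ℝ, 0 ≤ R ∧ ∀ᵐ x ∂μ, |x.1| ≤ R ∧ |x.2| ≤ R := by
    obtain ⟨K, hK, hK0⟩ := hcpt
    obtain ⟨R, hR⟩ := hK.isBounded.exists_norm_le
    refine ⟨max R 0, le_max_right _ _, ?_⟩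
    have : ∀ᵐ x ∂μ, x ∈ K := by rw [ae_iff]; exact hK0
    filter_upwards [this] with x hx
    have h := (hR x hx).trans (le_max_left R 0)
    rw [Prod.norm_def, max_le_iff] at h
    exact h
  have hfstP : IsProbabilityMeasure (μ.map Prod.fst) :=
    Measure.isProbabilityMeasure_map measurable_fst.aemeasurable
  have hsndP : IsProbabilityMeasure (μ.map Prod.snd) :=
    Measure.isProbabilityMeasure_map measurable_snd.aemeasurable
  have hfst : (μ.map Prod.fst) (Icc (-R) R)ᶜ = 0 := by
    rw [Measure.map_apply measurable_fst measurableSet_Icc.compl]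
    have : ∀ᵐ x ∂μ, x.1 ∈ Icc (-R) R := hμ.mono fun x hx => abs_le.1 hx.1
    exact ae_iff.1 this
  have hsnd : (μ.map Prod.snd) (Icc (-R) R)ᶜ = 0 := by
    rw [Measure.map_apply measurable_snd measurableSet_Icc.compl]
    have : ∀ᵐ x ∂μ, x.2 ∈ Icc (-R) R := hμ.mono fun x hx => abs_le.1 hx.2
    exact ae_iff.1 this
  set D : ℝ := 2 * R + 1 with hDdef
  have hD : 0 < D := by positivity
  refine le_of_forall_pos_le_add fun η hη => ?_
  obtain ⟨ε, hε, hεη⟩ : ∃ ε : ℝ, 0 < ε ∧ 3 * ε = η := ⟨η / 3, by positivity, by ring⟩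
  set s : ℝ := γ q + ε with hs
  have hPq := hP (γ q) q hq0
  rw [hγ q hq0] at hPq
  have hsum := summable_Psi B hc0 hd0 p hp0 τ1 τ2 hA hA1 hcA hdA hε hPq
  rw [← hs] at hsum
  have hPsi0 : ∀ k, 0 ≤ PsiSV B p τ1 τ2 k s q := fun k =>
    Finset.sum_nonneg fun f _ => psiSV_nonneg B hc0 hd0 p hp0 τ1 τ2 s q _
  obtain ⟨C1, hC1, hspec1⟩ := momZ_le_of_spec (μ.map Prod.fst) hR hfst hq0 hq1 (hτ1 q hq0).2 hε (D / a)
  obtain ⟨C2, hC2, hspec2⟩ := momZ_le_of_spec (μ.map Prod.snd) hR hsnd hq0 hq1 (hτ2 q hq0).2 hε (D / a)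
  set C : ℝ := max C1 C2 with hCdef
  have hC : 0 < C := lt_max_of_lt_left hC1
  have hspec : ∀ l r, 0 < r → r ≤ D / a →
      momZ (μ.map (B.projW l)) q r ≤ ENNReal.ofReal (C * r ^ (-tauW B τ1 τ2 l q - ε)) := by
    intro l r hr hr'
    unfold IFSData.projW tauW
    split_ifs
    · refine (hspec1 r hr hr').trans (ENNReal.ofReal_le_ofReal ?_)
      gcongr
      exact le_max_left _ _
    · refine (hspec2 r hr hr').trans (ENNReal.ofReal_le_ofReal ?_)
      gcongr
      exact le_max_right _ _
  obtain ⟨K, hK0, hK⟩ : ∃ K : ℝ, 0 < K ∧ ∀ l, D ^ (s - tauW B τ1 τ2 l q) ≤ K ∧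
      (D / a) ^ (s - tauW B τ1 τ2 l q) ≤ K := by
    have q1 : 0 < D ^ (s - τ1 q) := by positivity
    have q2 : 0 < D ^ (s - τ2 q) := by positivity
    have q3 : 0 < (D / a) ^ (s - τ1 q) := by positivity
    have q4 : 0 < (D / a) ^ (s - τ2 q) := by positivity
    refine ⟨D ^ (s - τ1 q) + D ^ (s - τ2 q) + (D / a) ^ (s - τ1 q) + (D / a) ^ (s - τ2 q),
      by positivity, fun l => ?_⟩
    unfold tauW
    split_ifs <;> constructor <;> linarith
  set T : ℝ := ∑' k, PsiSV B p τ1 τ2 k s q with hT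
  have hT0 : 0 ≤ T := tsum_nonneg hPsi0
  -- main estimate
  have main : ∀ δ, 0 < δ → δ ≤ 1 →
      momZ μ q δ ≤ ENNReal.ofReal (C * K * T * δ ^ (-s - ε)) := by
    intro δ hδ hδ1
    have hρ0 : 0 < δ / D := by positivity
    have hρ : δ / D ≤ 1 := by rw [div_le_one hD]; linarith
    set G : List ι → ENNReal := fun l =>
      ENNReal.ofReal (C * K * δ ^ (-s - ε) * psiSV B p τ1 τ2 s q l) with hG
    have hGb : ∀ l i, δ / D ≤ B.alpha2 l → B.alpha2 (l ++ [i]) < δ / D →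
        ENNReal.ofReal (wordProb p (l ++ [i])) ^ q * momZ (μ.map (B.Sw (l ++ [i]))) q δ
          ≤ G (l ++ [i]) := by
      intro l i h1 h2
      have hlow : a * (δ / D) ≤ B.alpha2 (l ++ [i]) := by
        obtain ⟨h3, h4⟩ := B.dims_append_ge hc0 hd0 hca hda l i
        refine (mul_le_mul_of_nonneg_left h1 ha.le).trans ?_
        refine le_min ?_ ?_
        · exact le_trans (by gcongr; exact min_le_left _ _) h3
        · exact le_trans (by gcongr; exact min_le_right _ _) h4
      set w := l ++ [i] with hw
      obtain ⟨hb, hh⟩ := B.dims_pos hc0 hd0 w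
      have ha2 : 0 < B.alpha2 w := lt_min hb hh
      have ha1 : 0 < B.alpha1 w := lt_max_of_lt_left hb
      have ha12 : B.alpha2 w ≤ B.alpha1 w := min_le_max
      have ha11 : B.alpha1 w ≤ 1 := by
        obtain ⟨h3, h4⟩ := B.dims_le hc0 hd0 hA.le hcA hdA w
        exact (max_le h3 h4).trans (pow_le_one₀ hA.le hA1.le)
      have hwp := wordProb_pos p hp0 w
      have hr : δ / B.alpha1 w ≤ D / a := by
        rw [← mul_div_assoc, div_le_iff₀ hD] at hlow
        rw [div_le_div_iff₀ ha1 ha]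
        nlinarith
      have h5 := (momZ_cyl B hc0 hd0 μ hμ hD (by linarith) w h2 hq1).trans
        (hspec w _ (by positivity) hr)
      have h6 := scale_ineq (t := tauW B τ1 τ2 w q) hδ hD ha ha2 ha1 ha11 hε h2 hlow
        (hK w).1 (hK w).2
      rw [ENNReal.ofReal_rpow_of_pos hwp]
      refine (mul_le_mul_right h5 _).trans ?_
      rw [← ENNReal.ofReal_mul (by positivity)]
      apply ENNReal.ofReal_le_ofReal
      calc wordProb p w ^ q * (C * (δ / B.alpha1 w) ^ (-tauW B τ1 τ2 w q - ε))
          ≤ wordProb p w ^ q * (C * (K * δ ^ (-s - ε) * (B.alpha1 w ^ tauW B τ1 τ2 w q *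
              B.alpha2 w ^ (s - tauW B τ1 τ2 w q)))) := by gcongr
        _ = _ := by unfold psiSV; ring
    obtain ⟨k, hk⟩ := exists_pow_lt_of_lt_one hρ0 hA1
    have h1 := momZ_decomp B p hp0 μ hself hq0 hq1 δ (δ / D) hρ G hGb k
    have h2 : ∀ f : Fin k → ι, ¬ δ / D ≤ B.alpha2 (List.ofFn f) := by
      intro f h
      have h3 := (B.dims_le hc0 hd0 hA.le hcA hdA (List.ofFn f)).1
      rw [List.length_ofFn] at h3
      have h4 : B.alpha2 (List.ofFn f) ≤ A ^ k := (min_le_left _ _).trans h3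
      linarith
    simp only [h2, if_false, Finset.sum_const_zero, zero_add] at h1
    refine h1.trans ?_
    have h3 : ∀ j, ∑ f : Fin j → ι, G (List.ofFn f)
        = ENNReal.ofReal (C * K * δ ^ (-s - ε) * PsiSV B p τ1 τ2 j s q) := by
      intro j
      unfold PsiSV
      rw [Finset.mul_sum, ENNReal.ofReal_sum_of_nonneg]
      intro f _
      have := psiSV_nonneg B hc0 hd0 p hp0 τ1 τ2 s q (List.ofFn f)
      positivity
    simp only [h3]
    rw [← ENNReal.ofReal_sum_of_nonneg (fun j _ => by have := hPsi0 j; positivity)]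
    apply ENNReal.ofReal_le_ofReal
    rw [← Finset.mul_sum]
    have h4 := hsum.sum_le_tsum (Finset.range (k + 1)) (fun j _ => hPsi0 j)
    calc _ ≤ C * K * δ ^ (-s - ε) * T := by gcongr
      _ = _ := by ring
  -- conclusion
  have hfin : ∀ δ, 0 < δ → δ ≤ 1 → momZ μ q δ ≠ ⊤ := fun δ h1 h2 =>
    ((main δ h1 h2).trans_lt ENNReal.ofReal_lt_top).ne
  have hone : ∀ δ, 0 < δ → δ ≤ 1 → 1 ≤ (momZ μ q δ).toReal := fun δ h1 h2 => by
    have := ENNReal.toReal_mono (hfin δ h1 h2) (one_le_momZ μ hq1 δ)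
    simpa using this
  unfold upperLq
  refine limsup_le_of_le (isCoboundedUnder_le_of_eventually_le _ (x := 0) ?_) ?_
  · filter_upwards [Ioo_mem_nhdsGT (zero_lt_one (α := ℝ))] with δ hδ
    rw [integral_eq_momZ μ (hfin δ hδ.1 hδ.2.le)]
    have := Real.log_neg hδ.1 hδ.2
    exact div_nonneg (Real.log_nonneg (hone δ hδ.1 hδ.2.le)) (by linarith)
  · have hlarge := (tendsto_rpow_neg_nhdsGT_zero (y := -ε) (by linarith)).eventually_ge_atTop
      (C * K * T)
    filter_upwards [Ioo_mem_nhdsGT (zero_lt_one (α := ℝ)), hlarge] with δ hδ hδ2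
    rw [integral_eq_momZ μ (hfin δ hδ.1 hδ.2.le)]
    have hδ0 := hδ.1
    have hl := Real.log_neg hδ.1 hδ.2
    have h1 : (momZ μ q δ).toReal ≤ C * K * T * δ ^ (-s - ε) :=
      ENNReal.toReal_le_of_le_ofReal (by positivity) (main δ hδ.1 hδ.2.le)
    have h2 : C * K * T * δ ^ (-s - ε) ≤ δ ^ (-(γ q + η)) := by
      calc _ ≤ δ ^ (-ε) * δ ^ (-s - ε) := by gcongr
        _ = _ := by rw [← Real.rpow_add hδ.1]; congr 1; rw [hs, ← hεη]; ring
    rw [div_le_iff₀ (by linarith)]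
    have h3 := Real.log_le_log (by linarith [hone δ hδ.1 hδ.2.le]) (h1.trans h2)
    rw [Real.log_rpow hδ.1] at h3
    linarith
end
end
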